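/- arXiv:math/0312285 — 11 statements merged into one kernel-verified Lean document; each statement's English description precedes it below -/
import Mathlib

section
/- Let a, c ∈ ℂ with a ∉ {0, 1, 3/2, 2}, c ≠ 0, (a-1)^2 - 4c ≠ 0 and a^6 - 4a^5 + 5a^4 - 2a^3 - 32a^3*c + 144c*a^2 - 216c*a + 108c ≠ 0. Set d = a(a-2)/(2a-3), b = (2a-3)c/(a-1)^2 + a^2/4, t = a^3(a-2)/(2a-3)^3 and s = 4c/(a-1)^2. Then there exist k, m, n, p, u ∈ ℂ with k ≠ 0 such that the following identities hold in the polynomial ring ℂ[X]: (i) k·X·(X-m)^2 - (X-u) = k·(X-1)·(X-n)^2; (ii) k·X·(X-m)^2 - t·(X-u) = k·(X-d)·(X-p)^2; (iii) k·X·(X-m)^2 - s·(X-u) = k·(X^3 - a·X^2 + b·X - c). -/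
open Polynomial

/-- existence of a degree 3 Frey-Kani covering of generic type
for the genus 2 curve `Y² = x(x-1)(x-d)(x³-ax²+bx-c)`. -/
theorem stmt_0 (a c : ℂ) (ha0 : a ≠ 0) (ha1 : a ≠ 1) (ha32 : a ≠ 3/2) (ha2 : a ≠ 2)
    (hc : c ≠ 0) (hdisc : (a - 1) ^ 2 - 4 * c ≠ 0)
    (hC : a ^ 6 - 4 * a ^ 5 + 5 * a ^ 4 - 2 * a ^ 3 - 32 * a ^ 3 * c + 144 * c * a ^ 2
      - 216 * c * a + 108 * c ≠ 0)
    (d : ℂ) (hd : d = a * (a - 2) / (2 * a - 3))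
    (b : ℂ) (hb : b = (2 * a - 3) * c / (a - 1) ^ 2 + a ^ 2 / 4)
    (t : ℂ) (ht : t = a ^ 3 * (a - 2) / (2 * a - 3) ^ 3)
    (s : ℂ) (hs : s = 4 * c / (a - 1) ^ 2) :
    ∃ k m n p u : ℂ, k ≠ 0 ∧
      (C k * (X * (X - C m) ^ 2) - (X - C u)
        = C k * ((X - 1) * (X - C n) ^ 2)) ∧
      (C k * (X * (X - C m) ^ 2) - C t * (X - C u)
        = C k * ((X - C d) * (X - C p) ^ 2)) ∧
      (C k * (X * (X - C m) ^ 2) - C s * (X - C u)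
        = C k * (X ^ 3 - C a * X ^ 2 + C b * X - C c)) := by
  have h3 : 2 * a - 3 ≠ 0 := fun h => ha32 (by linear_combination h / 2)
  have h1 : a - 1 ≠ 0 := sub_ne_zero.mpr ha1
  subst hd hb ht hs
  refine ⟨-4 / (2 * a - 3), a / 2, (a - 1) / 2, a * (a - 1) / (2 * (2 * a - 3)),
    (a - 1) ^ 2 / (2 * a - 3), div_ne_zero (by norm_num) h3, ?_, ?_, ?_⟩
  all_goals
    refine Polynomial.funext fun x => ?_
    simp only [eval_sub, eval_add, eval_mul, eval_pow, eval_C, eval_X, eval_one]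
    field_simp
    ring
end

section
/- Let a, c ∈ ℂ with a ∉ {0, 1, 3/2, 2, 3}, c ≠ 0, (a-1)^2 - 4c ≠ 0, and set t = a^3(a-2)/(2a-3)^3, s = 4c/(a-1)^2. Assume t ∉ {0,1}, s ∉ {0,1}, t ≠ s, and set λ = t(s-1)/(s(t-1)); assume λ ∉ {0,1}. Let A = a^12 - 8a^11 + 16c^2*a^8 + 11664c^2 + 36720c^2*a^4 - 69984c^2*a^3 - 192c^2*a^7 + 77760c^2*a^2 - 46656c^2*a + 1920c^2*a^6 - 11232c^2*a^5 - 4a^10*c + 26a^10 - 44a^9 + 41a^8 - 20a^7 + 220a^8*c - 904a^7*c + 1740a^6*c - 1800a^5*c - 8a^9*c - 216c*a^3 + 4a^6 + 972c*a^4, and C = a^6 - 4a^5 + 5a^4 - 2a^3 - 32a^3*c + 144c*a^2 - 216c*a + 108c; assume C ≠ 0. Then 256(λ^2-λ+1)^3/(λ^2(λ-1)^2) = (16/C^2)·A^3/(a^6·c^2·(a-1)^2·(a-2)^2·(a-3)^6·((a-1)^2-4c)^2). -/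
/-- the explicit formula for the j-invariant of the degree 3 elliptic
subcover `E₁ : y² = z(z-1)(z-t)(z-s)` of the genus 2 curve of Lemma 5.1,
in terms of the parameters `a` and `c`. -/
theorem stmt_1 (a c : ℂ) (ha0 : a ≠ 0) (ha1 : a ≠ 1) (ha32 : a ≠ 3/2) (ha2 : a ≠ 2)
    (ha3 : a ≠ 3) (hc : c ≠ 0) (hdisc : (a - 1) ^ 2 - 4 * c ≠ 0)
    (t : ℂ) (ht : t = a ^ 3 * (a - 2) / (2 * a - 3) ^ 3)
    (s : ℂ) (hs : s = 4 * c / (a - 1) ^ 2)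
    (ht0 : t ≠ 0) (ht1 : t ≠ 1) (hs0 : s ≠ 0) (hs1 : s ≠ 1) (hts : t ≠ s)
    (lam : ℂ) (hlam : lam = t * (s - 1) / (s * (t - 1)))
    (hlam0 : lam ≠ 0) (hlam1 : lam ≠ 1)
    (A : ℂ)
    (hA : A = a ^ 12 - 8 * a ^ 11 + 16 * c ^ 2 * a ^ 8 + 11664 * c ^ 2
      + 36720 * c ^ 2 * a ^ 4 - 69984 * c ^ 2 * a ^ 3 - 192 * c ^ 2 * a ^ 7
      + 77760 * c ^ 2 * a ^ 2 - 46656 * c ^ 2 * a + 1920 * c ^ 2 * a ^ 6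
      - 11232 * c ^ 2 * a ^ 5 - 4 * a ^ 10 * c + 26 * a ^ 10 - 44 * a ^ 9
      + 41 * a ^ 8 - 20 * a ^ 7 + 220 * a ^ 8 * c - 904 * a ^ 7 * c
      + 1740 * a ^ 6 * c - 1800 * a ^ 5 * c - 8 * a ^ 9 * c - 216 * c * a ^ 3
      + 4 * a ^ 6 + 972 * c * a ^ 4)
    (Cq : ℂ)
    (hCq : Cq = a ^ 6 - 4 * a ^ 5 + 5 * a ^ 4 - 2 * a ^ 3 - 32 * a ^ 3 * c
      + 144 * c * a ^ 2 - 216 * c * a + 108 * c)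
    (hCq0 : Cq ≠ 0) :
    256 * (lam ^ 2 - lam + 1) ^ 3 / (lam ^ 2 * (lam - 1) ^ 2)
      = (16 / Cq ^ 2) * A ^ 3
        / (a ^ 6 * c ^ 2 * (a - 1) ^ 2 * (a - 2) ^ 2 * (a - 3) ^ 6
          * ((a - 1) ^ 2 - 4 * c) ^ 2) := by
  have hd : a * 2 - 3 ≠ 0 := fun h => ha32 (by linear_combination h / 2)
  have h1 : a - 1 ≠ 0 := sub_ne_zero.mpr ha1
  have h2 : a - 2 ≠ 0 := sub_ne_zero.mpr ha2
  have h3 : a - 3 ≠ 0 := sub_ne_zero.mpr ha3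
  obtain ⟨N, hN⟩ : ∃ N, N = -(a ^ 3 * (a - 2) * ((a - 1) ^ 2 - 4 * c)) := ⟨_, rfl⟩
  obtain ⟨M, hM⟩ : ∃ M, M = 4 * c * (a - 1) * (a - 3) ^ 3 := ⟨_, rfl⟩
  have hN0 : N ≠ 0 := by
    rw [hN]
    exact neg_ne_zero.mpr (mul_ne_zero (mul_ne_zero (pow_ne_zero _ ha0) h2) hdisc)
  have hM0 : M ≠ 0 := by
    rw [hM]
    exact mul_ne_zero (mul_ne_zero (mul_ne_zero (by norm_num) hc) h1) (pow_ne_zero _ h3)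
  have hNM : N - M = -Cq := by rw [hN, hM, hCq]; ring
  have hA' : A = N ^ 2 - N * M + M ^ 2 := by rw [hN, hM, hA]; ring
  have hlamNM : lam = N / M := by
    have ht' : t - 1 = (a - 1) * (a - 3) ^ 3 / (2 * a - 3) ^ 3 := by
      rw [ht]; field_simp; ring
    have hs' : s - 1 = -((a - 1) ^ 2 - 4 * c) / (a - 1) ^ 2 := by
      rw [hs]; field_simp; ring
    rw [hlam, ht', hs', ht, hs, hN, hM]
    field_simp
  have hden : 16 * (a ^ 6 * c ^ 2 * (a - 1) ^ 2 * (a - 2) ^ 2 * (a - 3) ^ 6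
      * ((a - 1) ^ 2 - 4 * c) ^ 2) = N ^ 2 * M ^ 2 := by rw [hN, hM]; ring
  have hsub : lam - 1 = -Cq / M := by rw [hlamNM, ← hNM]; field_simp
  have hquad : lam ^ 2 - lam + 1 = A / M ^ 2 := by rw [hlamNM, hA']; field_simp
  rw [eq_div_of_mul_eq (by norm_num : (16 : ℂ) ≠ 0) ((mul_comm _ _).trans hden),
    hquad, hsub, hlamNM]
  field_simp
  ring
end

section
/- Let w₁, w₂ ∈ ℂ satisfy w₁^4 - 4w₁^3·w₂ + 6w₁^2·w₂ - 4w₁·w₂ + w₂^2 = 0, with w₁ ∉ {0,1} and with each of 4w₁^3 - 6w₁^2 + 3w₁ - w₂, 4w₁^3 - 3w₁^2 - w₂, and 4w₁^3 - 9w₁^2 + 6w₁ - w₂ nonzero. Define w₃ = (4w₁^3 - 7w₁^2 + 4w₁ - w₂)^3·(4w₁^3 - 3w₁^2 - w₂) / (16·w₁^3·(w₁-1)^3·(4w₁^3 - 6w₁^2 + 3w₁ - w₂)) and s = -27·( w₁(w₁-1)·(4w₁^3 - 7w₁^2 + 4w₁ - w₂)·(4w₁^3 - 5w₁^2 + 2w₁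 - w₂) / ((4w₁^3 - 9w₁^2 + 6w₁ - w₂)·(4w₁^3 - 3w₁^2 - w₂)·(4w₁^3 - 6w₁^2 + 3w₁ - w₂)) )^2. Then there exist k, p, q ∈ ℂ with k ≠ 0 such that the following identities hold in ℂ[X]: (i) k·(X-w₁)^3 - s·X·(X-1) = k·(X-w₂)·(X-p)^2; (ii) k·(X-w₁)^3 - X·(X-1) = k·(X-w₃)·(X-q)^2. -/
open Polynomial

/-- The plane curve relating `w₁` and `w₂` is rational, parametrized by the double
point `p` of the fibre through `w₂`. -/
theorem exists_param_of_rel {w₁ w₂ : ℂ}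
    (hrel : w₁ ^ 4 - 4 * w₁ ^ 3 * w₂ + 6 * w₁ ^ 2 * w₂ - 4 * w₁ * w₂ + w₂ ^ 2 = 0)
    (hw0 : w₁ ≠ 0) (hw1 : w₁ ≠ 1) :
    ∃ p : ℂ, 2 * p - 1 ≠ 0 ∧ w₁ = p * (2 - p) / (2 * p - 1) ∧
      w₂ = p * (2 - p) ^ 3 / (2 * p - 1) ^ 3 := by
  have hw2 : w₂ ≠ 0 := by
    rintro rfl
    exact hw0 (by simpa using hrel)
  have hw1' : 1 - w₁ ≠ 0 := sub_ne_zero.mpr hw1.symm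
  obtain ⟨p, hp⟩ : ∃ p, p * (2 * w₂ * (1 - w₁)) = w₁ ^ 3 - w₁ * w₂ :=
    ⟨(w₁ ^ 3 - w₁ * w₂) / (2 * w₂ * (1 - w₁)), by field_simp⟩
  have hcrit : w₁ * (2 * p - 1) = p * (2 - p) := by
    have h : (4 * w₂ ^ 2 * (1 - w₁) ^ 2) * (w₁ * (2 * p - 1) - p * (2 - p)) = 0 := by
      linear_combination (p * (2 * w₂ * (1 - w₁)) + (w₁ ^ 3 - w₁ * w₂)
        - 4 * w₂ * (1 - w₁) ^ 2) * hp + w₁ ^ 2 * hrel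
    have := (mul_eq_zero.mp h).resolve_left (by simp [hw2, hw1'])
    linear_combination this
  have hd : 2 * p - 1 ≠ 0 := by
    intro hd
    have h : (3 : ℂ) = 0 := by
      linear_combination (4 * w₁ - 3 + 2 * p) * hd - 4 * hcrit
    norm_num at h
  have hw : w₁ = p * (2 - p) / (2 * p - 1) := by
    rw [eq_div_iff hd, hcrit]
  have hp0 : p ≠ 0 := by
    rintro rfl
    simp [hw0] at hw
  have hfib : w₂ * p ^ 2 = w₁ ^ 3 := by
    linear_combination w₂ * hcrit + hp
  refine ⟨p, hd, hw, ?_⟩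
  have : w₂ = w₁ ^ 3 / p ^ 2 := by
    rw [eq_div_iff (pow_ne_zero 2 hp0), hfib]
  rw [this, hw]
  field_simp

/-- Coefficientwise criterion for a cubic of the pencil to have a double root. -/
theorem cubic_eq_of_coeffs {R : Type*} [CommRing R] {k s w v p : R}
    (h₂ : 3 * k * w + s = k * (v + 2 * p))
    (h₁ : 3 * k * w ^ 2 + s = k * (p ^ 2 + 2 * p * v))
    (h₀ : k * w ^ 3 = k * (v * p ^ 2)) :
    C k * (X - C w) ^ 3 - C s * (X * (X - 1)) = C k * ((X - C v) * (X - C p) ^ 2) := by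
  have e₂ := congrArg (C : R → R[X]) h₂
  have e₁ := congrArg (C : R → R[X]) h₁
  have e₀ := congrArg (C : R → R[X]) h₀
  simp only [map_add, map_mul, map_pow, map_ofNat] at e₂ e₁ e₀
  linear_combination -X ^ 2 * e₂ + X * e₁ - e₀

/-- existence of a degenerate degree 3 Frey-Kani covering for the
genus 2 curve `Y² = x(x-1)(x-w₁)(x-w₂)(x-w₃)`. -/
theorem stmt_2 (w₁ w₂ : ℂ)
    (hrel : w₁ ^ 4 - 4 * w₁ ^ 3 * w₂ + 6 * w₁ ^ 2 * w₂ - 4 * w₁ * w₂ + w₂ ^ 2 = 0)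
    (hw0 : w₁ ≠ 0) (hw1 : w₁ ≠ 1)
    (h1 : 4 * w₁ ^ 3 - 6 * w₁ ^ 2 + 3 * w₁ - w₂ ≠ 0)
    (h2 : 4 * w₁ ^ 3 - 3 * w₁ ^ 2 - w₂ ≠ 0)
    (h3 : 4 * w₁ ^ 3 - 9 * w₁ ^ 2 + 6 * w₁ - w₂ ≠ 0)
    (w₃ : ℂ)
    (hw₃ : w₃ = (4 * w₁ ^ 3 - 7 * w₁ ^ 2 + 4 * w₁ - w₂) ^ 3 * (4 * w₁ ^ 3 - 3 * w₁ ^ 2 - w₂)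
      / (16 * w₁ ^ 3 * (w₁ - 1) ^ 3 * (4 * w₁ ^ 3 - 6 * w₁ ^ 2 + 3 * w₁ - w₂)))
    (s : ℂ)
    (hs : s = -27 * (w₁ * (w₁ - 1) * (4 * w₁ ^ 3 - 7 * w₁ ^ 2 + 4 * w₁ - w₂)
        * (4 * w₁ ^ 3 - 5 * w₁ ^ 2 + 2 * w₁ - w₂)
      / ((4 * w₁ ^ 3 - 9 * w₁ ^ 2 + 6 * w₁ - w₂) * (4 * w₁ ^ 3 - 3 * w₁ ^ 2 - w₂)
        * (4 * w₁ ^ 3 - 6 * w₁ ^ 2 + 3 * w₁ - w₂))) ^ 2) :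
    ∃ k p q : ℂ, k ≠ 0 ∧
      (C k * (X - C w₁) ^ 3 - C s * (X * (X - 1))
        = C k * ((X - C w₂) * (X - C p) ^ 2)) ∧
      (C k * (X - C w₁) ^ 3 - X * (X - 1)
        = C k * ((X - C w₃) * (X - C q) ^ 2)) := by
  obtain ⟨p, hd, rfl, rfl⟩ := exists_param_of_rel hrel hw0 hw1
  have ha : p ≠ 0 := by
    rintro rfl
    simp at hw0
  have hb : 2 - p ≠ 0 := by
    intro h
    simp [h] at hw0
  have hc : p ^ 2 - 1 ≠ 0 := by
    intro h
    apply hw1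
    rw [div_eq_one_iff_eq hd]
    linear_combination -h
  have hc₁ : p + 1 ≠ 0 := fun h => hc (by linear_combination (p - 1) * h)
  set d := 2 * p - 1 with hdef
  have hsub : p * (2 - p) / d - 1 = -(p ^ 2 - 1) / d := by
    field_simp
    rw [hdef]
    ring
  have f₆ : 4 * (p * (2 - p) / d) ^ 3 - 6 * (p * (2 - p) / d) ^ 2 + 3 * (p * (2 - p) / d)
      - p * (2 - p) ^ 3 / d ^ 3 = p * (2 - p) * (p ^ 2 - 1) / d := by
    field_simp
    rw [hdef]
    ring
  have f₃ : 4 * (p * (2 - p) / d) ^ 3 - 3 * (p * (2 - p) / d) ^ 2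
      - p * (2 - p) ^ 3 / d ^ 3 = -2 * p * (2 - p) ^ 2 * (p ^ 2 - 1) / d ^ 2 := by
    field_simp
    rw [hdef]
    ring
  have f₉ : 4 * (p * (2 - p) / d) ^ 3 - 9 * (p * (2 - p) / d) ^ 2 + 6 * (p * (2 - p) / d)
      - p * (2 - p) ^ 3 / d ^ 3 = 2 * p * (2 - p) * (p ^ 2 - 1) * (p + 1) / d ^ 2 := by
    field_simp
    rw [hdef]
    ring
  have f₇ : 4 * (p * (2 - p) / d) ^ 3 - 7 * (p * (2 - p) / d) ^ 2 + 4 * (p * (2 - p) / d)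
      - p * (2 - p) ^ 3 / d ^ 3 = 2 * p ^ 2 * (2 - p) * (p ^ 2 - 1) / d ^ 2 := by
    field_simp
    rw [hdef]
    ring
  have f₅ : 4 * (p * (2 - p) / d) ^ 3 - 5 * (p * (2 - p) / d) ^ 2 + 2 * (p * (2 - p) / d)
      - p * (2 - p) ^ 3 / d ^ 3 = 2 * p * (2 - p) * (p ^ 2 - 1) * (p - 1) / d ^ 2 := by
    field_simp
    rw [hdef]
    ring
  have hw₃' : w₃ = p ^ 3 * (2 - p) / d := by
    rw [hw₃, f₇, f₃, f₆, hsub]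
    field_simp
    ring
  have hs' : s = -27 * p ^ 2 * (p - 1) ^ 2 / ((2 - p) ^ 2 * (p + 1) ^ 2 * d ^ 2) := by
    rw [hs, f₇, f₅, f₉, f₃, f₆, hsub]
    field_simp
  clear hw₃ hs f₃ f₅ f₆ f₇ f₉ h1 h2 h3 hsub hrel hw0 hw1
  subst hw₃' hs'
  refine ⟨-d / ((2 - p) ^ 2 * (p + 1) ^ 2), p, (p - 2) / d, ?_, ?_, ?_⟩
  · exact div_ne_zero (neg_ne_zero.mpr hd)
      (mul_ne_zero (pow_ne_zero 2 hb) (pow_ne_zero 2 hc₁))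
  · apply cubic_eq_of_coeffs <;> field_simp <;> rw [hdef] <;> ring
  · rw [← one_mul (X * (X - 1) : ℂ[X]), ← C_1]
    apply cubic_eq_of_coeffs <;> field_simp <;> (try rw [hdef]) <;> ring
end

section
/- Let w₁, w₂ ∈ ℂ satisfy w₁^4 - 4w₁^3·w₂ + 6w₁^2·w₂ - 4w₁·w₂ + w₂^2 = 0, with w₁ ∉ {0,1}, with 4w₁^3 - 6w₁^2 + 3w₁ - w₂, 4w₁^3 - 3w₁^2 - w₂, 4w₁^3 - 9w₁^2 + 6w₁ - w₂ all nonzero, and let s = -27·( w₁(w₁-1)·(4w₁^3 - 7w₁^2 + 4w₁ - w₂)·(4w₁^3 - 5w₁^2 + 2w₁ - w₂) / ((4w₁^3 - 9w₁^2 + 6w₁ - w₂)·(4w₁^3 - 3w₁^2 - w₂)·(4w₁^3 - 6w₁^2 + 3w₁ - w₂)) )^2. Assume s ∉ {0,1} and set j₁ = 256(s^2-s+1)^3/(s^2(s-1)^2). Then 2617344w₁^2 + 38637j₁w₁^7 - 17496j₁w₁^6 - 29207808w₁^5 - 7569408w₁^3 - 7569408w₁^15 - 729w₁^4·j₁ +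 5103j₁w₁^5 + 69984j₁w₁^9 - 60507j₁w₁^8 + 65536 - 589824w₁ + 16411392w₁^4 - 29207808w₁^13 + 44960208w₁^12 - 60666336w₁^11 + 72010800w₁^10 + 44960208w₁^6 - 60666336w₁^7 + 72010800w₁^8 - 75998272w₁^9 + 16411392w₁^14 + 2617344w₁^16 - 589824w₁^17 - 60507j₁w₁^10 + 38637j₁w₁^11 - 17496j₁w₁^12 + 5103j₁w₁^13 - 729j₁w₁^14 + 65536w₁^18 = 0. -/
/-- On the curve relating `w₁` and `w₂`, there is a rational parameter `t`. -/
lemma exists_parameter (w₁ w₂ : ℂ)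
    (hrel : w₁ ^ 4 - 4 * w₁ ^ 3 * w₂ + 6 * w₁ ^ 2 * w₂ - 4 * w₁ * w₂ + w₂ ^ 2 = 0)
    (hw0 : w₁ ≠ 0) (hw1 : w₁ ≠ 1) :
    ∃ t : ℂ, w₁ * (2 * t - 1) = t ^ 2 - 1 ∧
      w₂ = 2 * w₁ ^ 3 - 3 * w₁ ^ 2 + 2 * w₁ + 2 * w₁ * (w₁ - 1) * (w₁ - t) := by
  have hw1' : w₁ - 1 ≠ 0 := sub_ne_zero.mpr hw1
  obtain ⟨r, hr⟩ : ∃ r : ℂ, w₂ = 2 * w₁ ^ 3 - 3 * w₁ ^ 2 + 2 * w₁ + 2 * w₁ * (w₁ - 1) * r :=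
    ⟨(w₂ - (2 * w₁ ^ 3 - 3 * w₁ ^ 2 + 2 * w₁)) / (2 * w₁ * (w₁ - 1)), by field_simp; ring⟩
  refine ⟨w₁ - r, ?_, by rw [hr]; ring⟩
  have h : (4 * w₁ ^ 2 * (w₁ - 1) ^ 2) * (w₁ ^ 2 - w₁ + 1 - r ^ 2) = 0 := by
    rw [hr] at hrel
    linear_combination -hrel
  have h' := (mul_eq_zero.mp h).resolve_left (by simp [hw0, hw1'])
  linear_combination h'

/-- The j-invariant of the Legendre curve with parameter `s = -27 t² (t - 1)² / d²`,
where `d = (t - 2)(t + 1)(2t - 1)`. -/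
lemma jInvariant_eq (t : ℂ) (ht0 : t ≠ 0) (ht1 : t - 1 ≠ 0) (ht2 : t - 2 ≠ 0)
    (ht3 : t + 1 ≠ 0) (ht4 : 2 * t - 1 ≠ 0) (hP : t ^ 2 - t + 1 ≠ 0) (s : ℂ)
    (hs : s = -27 * (t * (t - 1) / ((t - 2) * (t + 1) * (2 * t - 1))) ^ 2) :
    256 * (s ^ 2 - s + 1) ^ 3 / (s ^ 2 * (s - 1) ^ 2) =
      16 * (16 * (t ^ 2 - t + 1) ^ 6 - 108 * (t ^ 2 - t + 1) ^ 3 * (t * (t - 1)) ^ 2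
          + 729 * (t * (t - 1)) ^ 4) ^ 3
        / (729 * (t * (t - 1)) ^ 4 * (t ^ 2 - t + 1) ^ 6
          * ((t - 2) * (t + 1) * (2 * t - 1)) ^ 4) := by
  have hd : ((t - 2) * (t + 1) * (2 * t - 1)) ^ 2
      = 4 * (t ^ 2 - t + 1) ^ 3 - 27 * (t * (t - 1)) ^ 2 := by ring
  have hd0 : (t - 2) * (t + 1) * (2 * t - 1) ≠ 0 := by simp [*]
  have hq0 : t * (t - 1) ≠ 0 := by simp [*]
  generalize (t - 2) * (t + 1) * (2 * t - 1) = d at *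
  generalize t * (t - 1) = q at *
  generalize t ^ 2 - t + 1 = P at *
  have hs' : s = -27 * q ^ 2 / d ^ 2 := by rw [hs]; ring
  have hs1 : s - 1 = -(4 * P ^ 3) / d ^ 2 := by
    rw [hs']; field_simp; linear_combination -hd
  have hM : s ^ 2 - s + 1 = (16 * P ^ 6 - 108 * P ^ 3 * q ^ 2 + 729 * q ^ 4) / d ^ 4 := by
    rw [hs']; field_simp
    linear_combination (d ^ 2 + 4 * P ^ 3) * hd
  rw [hM, hs1, hs']
  field_simp
  ring


/-- the polynomial relation between the j-invariant `j₁` of the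
elliptic subcover `E₁ : y² = z(z-1)(z-s)` and `w₁` in the degenerate degree 3 case. -/
theorem stmt_3 (w₁ w₂ : ℂ)
    (hrel : w₁ ^ 4 - 4 * w₁ ^ 3 * w₂ + 6 * w₁ ^ 2 * w₂ - 4 * w₁ * w₂ + w₂ ^ 2 = 0)
    (hw0 : w₁ ≠ 0) (hw1 : w₁ ≠ 1)
    (h1 : 4 * w₁ ^ 3 - 6 * w₁ ^ 2 + 3 * w₁ - w₂ ≠ 0)
    (h2 : 4 * w₁ ^ 3 - 3 * w₁ ^ 2 - w₂ ≠ 0)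
    (h3 : 4 * w₁ ^ 3 - 9 * w₁ ^ 2 + 6 * w₁ - w₂ ≠ 0)
    (s : ℂ)
    (hs : s = -27 * (w₁ * (w₁ - 1) * (4 * w₁ ^ 3 - 7 * w₁ ^ 2 + 4 * w₁ - w₂)
        * (4 * w₁ ^ 3 - 5 * w₁ ^ 2 + 2 * w₁ - w₂)
      / ((4 * w₁ ^ 3 - 9 * w₁ ^ 2 + 6 * w₁ - w₂) * (4 * w₁ ^ 3 - 3 * w₁ ^ 2 - w₂)
        * (4 * w₁ ^ 3 - 6 * w₁ ^ 2 + 3 * w₁ - w₂))) ^ 2)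
    (hs0 : s ≠ 0) (hs1 : s ≠ 1)
    (j₁ : ℂ) (hj₁ : j₁ = 256 * (s ^ 2 - s + 1) ^ 3 / (s ^ 2 * (s - 1) ^ 2)) :
    2617344 * w₁ ^ 2 + 38637 * j₁ * w₁ ^ 7 - 17496 * j₁ * w₁ ^ 6 - 29207808 * w₁ ^ 5
      - 7569408 * w₁ ^ 3 - 7569408 * w₁ ^ 15 - 729 * w₁ ^ 4 * j₁ + 5103 * j₁ * w₁ ^ 5
      + 69984 * j₁ * w₁ ^ 9 - 60507 * j₁ * w₁ ^ 8 + 65536 - 589824 * w₁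
      + 16411392 * w₁ ^ 4 - 29207808 * w₁ ^ 13 + 44960208 * w₁ ^ 12
      - 60666336 * w₁ ^ 11 + 72010800 * w₁ ^ 10 + 44960208 * w₁ ^ 6
      - 60666336 * w₁ ^ 7 + 72010800 * w₁ ^ 8 - 75998272 * w₁ ^ 9
      + 16411392 * w₁ ^ 14 + 2617344 * w₁ ^ 16 - 589824 * w₁ ^ 17
      - 60507 * j₁ * w₁ ^ 10 + 38637 * j₁ * w₁ ^ 11 - 17496 * j₁ * w₁ ^ 12
      + 5103 * j₁ * w₁ ^ 13 - 729 * j₁ * w₁ ^ 14 + 65536 * w₁ ^ 18 = 0 := by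
  obtain ⟨t, hwt, hw₂⟩ := exists_parameter w₁ w₂ hrel hw0 hw1
  have e1 : 4 * w₁ ^ 3 - 6 * w₁ ^ 2 + 3 * w₁ - w₂ = w₁ * (w₁ - 1) * (2 * t - 1) := by
    rw [hw₂]; ring
  have e2 : 4 * w₁ ^ 3 - 3 * w₁ ^ 2 - w₂ = 2 * (w₁ * (w₁ - 1)) * (t + 1) := by
    rw [hw₂]; ring
  have e3 : 4 * w₁ ^ 3 - 9 * w₁ ^ 2 + 6 * w₁ - w₂ = 2 * (w₁ * (w₁ - 1)) * (t - 2) := by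
    rw [hw₂]; ring
  have e4 : 4 * w₁ ^ 3 - 7 * w₁ ^ 2 + 4 * w₁ - w₂ = 2 * (w₁ * (w₁ - 1)) * (t - 1) := by
    rw [hw₂]; ring
  have e5 : 4 * w₁ ^ 3 - 5 * w₁ ^ 2 + 2 * w₁ - w₂ = 2 * (w₁ * (w₁ - 1)) * t := by
    rw [hw₂]; ring
  rw [e1] at h1
  rw [e2] at h2
  rw [e3] at h3
  rw [e1, e2, e3, e4, e5] at hs
  have ht4 := right_ne_zero_of_mul h1
  have ht3 := right_ne_zero_of_mul h2
  have ht2 := right_ne_zero_of_mul h3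
  have hww := left_ne_zero_of_mul h1
  replace hs : s = -27 * (t * (t - 1) / ((t - 2) * (t + 1) * (2 * t - 1))) ^ 2 := by
    rw [hs]
    generalize w₁ * (w₁ - 1) = a at *
    field_simp
  have ht0 : t ≠ 0 := by
    rintro rfl
    exact hs0 (by rw [hs]; simp)
  have ht1 : t - 1 ≠ 0 := by
    intro h
    exact hs0 (by rw [hs, h]; simp)
  have hP : t ^ 2 - t + 1 ≠ 0 := by
    intro h
    apply hs1
    have hd : (t - 2) * (t + 1) * (2 * t - 1) ≠ 0 := by simp [ht2, ht3, ht4]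
    rw [hs, div_pow, ← mul_div_assoc, div_eq_one_iff_eq (pow_ne_zero 2 hd)]
    linear_combination -4 * (t ^ 2 - t + 1) ^ 2 * h
  rw [jInvariant_eq t ht0 ht1 ht2 ht3 ht4 hP s hs] at hj₁
  have hw : w₁ = (t ^ 2 - 1) / (2 * t - 1) := eq_div_of_mul_eq ht4 hwt
  have hN : 16 * w₁ ^ 6 - 48 * w₁ ^ 5 + 69 * w₁ ^ 4 - 58 * w₁ ^ 3 + 69 * w₁ ^ 2 - 48 * w₁ + 16
      = (16 * (t ^ 2 - t + 1) ^ 6 - 108 * (t ^ 2 - t + 1) ^ 3 * (t * (t - 1)) ^ 2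
          + 729 * (t * (t - 1)) ^ 4) / (2 * t - 1) ^ 6 := by
    rw [hw]; generalize hu : 2 * t - 1 = u at *; field_simp; rw [← hu]; ring
  have hQ : w₁ * (w₁ - 1) = t * (t - 1) * ((t - 2) * (t + 1)) / (2 * t - 1) ^ 2 := by
    rw [hw]; generalize hu : 2 * t - 1 = u at *; field_simp; rw [← hu]; ring
  have hR : w₁ ^ 2 - w₁ + 1 = (t ^ 2 - t + 1) ^ 2 / (2 * t - 1) ^ 2 := by
    rw [hw]; generalize hu : 2 * t - 1 = u at *; field_simp; rw [← hu]; ring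
  have key : 16 * (16 * w₁ ^ 6 - 48 * w₁ ^ 5 + 69 * w₁ ^ 4 - 58 * w₁ ^ 3 + 69 * w₁ ^ 2
      - 48 * w₁ + 16) ^ 3 = 729 * j₁ * (w₁ * (w₁ - 1)) ^ 4 * (w₁ ^ 2 - w₁ + 1) ^ 3 := by
    rw [hN, hQ, hR, hj₁]
    generalize 16 * (t ^ 2 - t + 1) ^ 6 - 108 * (t ^ 2 - t + 1) ^ 3 * (t * (t - 1)) ^ 2
          + 729 * (t * (t - 1)) ^ 4 = M
    generalize t ^ 2 - t + 1 = P at *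
    generalize 2 * t - 1 = u at *
    field_simp
  linear_combination key
end

section
/- Let w₁, w₂ ∈ ℂ satisfy w₁^4 - 4w₁^3·w₂ + 6w₁^2·w₂ - 4w₁·w₂ + w₂^2 = 0, with w₁ ∉ {0,1}, with 4w₁^3 - 6w₁^2 + 3w₁ - w₂ and 4w₁^3 - 3w₁^2 - w₂ nonzero, and define w₃ = (4w₁^3 - 7w₁^2 + 4w₁ - w₂)^3·(4w₁^3 - 3w₁^2 - w₂) / (16·w₁^3·(w₁-1)^3·(4w₁^3 - 6w₁^2 + 3w₁ - w₂)). Assume w₁, w₂, w₃ are pairwise distinct, set μ = (w₃ - w₁)/(w₂ - w₁) and j = 256(μ^2-μ+1)^3/(μ^2(μ-1)^2). Then 65536w₁^6 - 196608w₁^5 + 356352w₁^4 - 385024w₁^3 + (289536 - 9j)w₁^2 + (-129792 + 9j)w₁ + 35152 - 9j = 0. -/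
/-- the polynomial relation between the j-invariant `j` of the
complementary elliptic subcover `y² = (x-w₁)(x-w₂)(x-w₃)` and `w₁` in the
degenerate degree 3 case. -/
theorem stmt_4 (w₁ w₂ : ℂ)
    (hrel : w₁ ^ 4 - 4 * w₁ ^ 3 * w₂ + 6 * w₁ ^ 2 * w₂ - 4 * w₁ * w₂ + w₂ ^ 2 = 0)
    (hw0 : w₁ ≠ 0) (hw1 : w₁ ≠ 1)
    (h1 : 4 * w₁ ^ 3 - 6 * w₁ ^ 2 + 3 * w₁ - w₂ ≠ 0)
    (h2 : 4 * w₁ ^ 3 - 3 * w₁ ^ 2 - w₂ ≠ 0)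
    (w₃ : ℂ)
    (hw₃ : w₃ = (4 * w₁ ^ 3 - 7 * w₁ ^ 2 + 4 * w₁ - w₂) ^ 3 * (4 * w₁ ^ 3 - 3 * w₁ ^ 2 - w₂)
      / (16 * w₁ ^ 3 * (w₁ - 1) ^ 3 * (4 * w₁ ^ 3 - 6 * w₁ ^ 2 + 3 * w₁ - w₂)))
    (h12 : w₁ ≠ w₂) (h13 : w₁ ≠ w₃) (h23 : w₂ ≠ w₃)
    (μ : ℂ) (hμ : μ = (w₃ - w₁) / (w₂ - w₁))
    (j : ℂ) (hj : j = 256 * (μ ^ 2 - μ + 1) ^ 3 / (μ ^ 2 * (μ - 1) ^ 2)) :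
    65536 * w₁ ^ 6 - 196608 * w₁ ^ 5 + 356352 * w₁ ^ 4 - 385024 * w₁ ^ 3
      + (289536 - 9 * j) * w₁ ^ 2 + (-129792 + 9 * j) * w₁ + 35152 - 9 * j = 0 := by
  have hw1' : w₁ - 1 ≠ 0 := sub_ne_zero.mpr hw1
  -- `w₃` is the other root of the quadratic relation satisfied by `w₂`.
  have hconj : w₃ = 4 * w₁ ^ 3 - 6 * w₁ ^ 2 + 4 * w₁ - w₂ := by
    rw [hw₃, div_eq_iff (by simp [hw0, hw1', h1])]
    linear_combination (32 * w₁ ^ 6 - 96 * w₁ ^ 5 + 117 * w₁ ^ 4 - 68 * w₁ ^ 3 + 16 * w₁ ^ 2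
      + (-12 * w₁ ^ 3 + 18 * w₁ ^ 2 - 8 * w₁) * w₂ + w₂ ^ 2) * hrel
  have hu : w₂ - w₁ ≠ 0 := sub_ne_zero.mpr h12.symm
  have hv : w₃ - w₁ ≠ 0 := sub_ne_zero.mpr h13.symm
  have hvu : w₃ - w₂ ≠ 0 := sub_ne_zero.mpr h23.symm
  have hj' : j * ((w₂ - w₁) * (w₃ - w₁)) ^ 2 * (w₃ - w₂) ^ 2
      = 256 * ((w₃ - w₁) ^ 2 - (w₃ - w₁) * (w₂ - w₁) + (w₂ - w₁) ^ 2) ^ 3 := by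
    have hμ1 : μ - 1 = (w₃ - w₂) / (w₂ - w₁) := by rw [hμ]; field_simp; ring
    rw [hj, hμ1, hμ]
    field_simp
  have hprod : (w₂ - w₁) * (w₃ - w₁) = -3 * (w₁ * (w₁ - 1)) ^ 2 := by
    rw [hconj]; linear_combination -hrel
  have hdiff : (w₃ - w₂) ^ 2 = 16 * (w₁ * (w₁ - 1)) ^ 2 * (w₁ ^ 2 - w₁ + 1) := by
    rw [hconj]; linear_combination 4 * hrel
  have hnum : (w₃ - w₁) ^ 2 - (w₃ - w₁) * (w₂ - w₁) + (w₂ - w₁) ^ 2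
      = (w₁ * (w₁ - 1)) ^ 2 * (16 * w₁ ^ 2 - 16 * w₁ + 13) := by
    linear_combination hdiff + hprod
  rw [hprod, hdiff, hnum] at hj'
  have hne : 16 * (w₁ * (w₁ - 1)) ^ 6 ≠ 0 := by simp [hw0, hw1']
  refine (mul_eq_zero.mp ?_).resolve_left hne
  linear_combination -hj'
end

section
/- Let w₁, w₂ ∈ ℂ satisfy w₁^4 - 4w₁^3·w₂ + 6w₁^2·w₂ - 4w₁·w₂ + w₂^2 = 0, with w₁ ∉ {0,1} and 4w₁^3 - 6w₁^2 + 3w₁ - w₂, 4w₁^3 - 3w₁^2 - w₂, 4w₁^3 - 9w₁^2 + 6w₁ - w₂ all nonzero. Define w₃ = (4w₁^3 - 7w₁^2 + 4w₁ - w₂)^3·(4w₁^3 - 3w₁^2 - w₂)/(16w₁^3(w₁-1)^3(4w₁^3 - 6w₁^2 + 3w₁ - w₂)) and s = -27·( w₁(w₁-1)(4w₁^3 - 7w₁^2 + 4w₁ - w₂)(4w₁^3 - 5w₁^2 + 2w₁ - w₂)/((4w₁^3 - 9w₁^2 + 6w₁ - w₂)(4w₁^3 - 3w₁^2 - w₂)(4w₁^3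 - 6w₁^2 + 3w₁ - w₂)) )^2. Assume s ∉ {0,1}, assume w₁, w₂, w₃ pairwise distinct, and set j₁ = 256(s^2-s+1)^3/(s^2(s-1)^2), μ = (w₃-w₁)/(w₂-w₁), j = 256(μ^2-μ+1)^3/(μ^2(μ-1)^2). Define A(j) = (9j - 35152)^4; B(j) = -2187j^7 + 38996640j^6 - 277882258176j^5 + 998642127618048j^4 - 1868045010870009856j^3 + 1669509508048367910912j^2 - 543484034691057422696448j + 16612482057244821172518912; C(j) = 27j^8 + 1125216j^7 + 9650655872j^6 - 31593875152896j^5 + 27748804997283840j^4 + 1114515284358510673920j^3 - 6061989956030939246100480j^2 + 8346397859247767524611194880j + 353019691006036487376293855232; D(j) = (j^3 + 33120j^2 + 290490624j - 310747594752)^3. Then 256·A(j)·j₁^3 + 3·B(j)·j₁^2 + 6·C(j)·j₁ - D(j) = 0. -/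
/-- The cubic relation between the j-invariants `256 (x + 1) ^ 3 / x` and `256 (y + 1) ^ 3 / y`,
where `x = y ^ 3 / (3 * y + 16) ^ 2`. -/
lemma cubic_relation_of_parametrization (y : ℂ) (hy : y ≠ 0) (hy' : 3 * y + 16 ≠ 0) (j j₁ : ℂ)
    (hj : j = 256 * (y + 1) ^ 3 / y)
    (hj₁ : j₁ = 256 * (y ^ 3 + (3 * y + 16) ^ 2) ^ 3 / (y ^ 3 * (3 * y + 16) ^ 4)) :
    256 * (9 * j - 35152) ^ 4 * j₁ ^ 3
      + 3 * (-2187 * j ^ 7 + 38996640 * j ^ 6 - 277882258176 * j ^ 5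
        + 998642127618048 * j ^ 4 - 1868045010870009856 * j ^ 3
        + 1669509508048367910912 * j ^ 2 - 543484034691057422696448 * j
        + 16612482057244821172518912) * j₁ ^ 2
      + 6 * (27 * j ^ 8 + 1125216 * j ^ 7 + 9650655872 * j ^ 6
        - 31593875152896 * j ^ 5 + 27748804997283840 * j ^ 4
        + 1114515284358510673920 * j ^ 3 - 6061989956030939246100480 * j ^ 2
        + 8346397859247767524611194880 * j + 353019691006036487376293855232) * j₁
      - (j ^ 3 + 33120 * j ^ 2 + 290490624 * j - 310747594752) ^ 3 = 0 := by
  obtain ⟨z, hz⟩ : ∃ z, z = 3 * y + 16 := ⟨_, rfl⟩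
  rw [← hz] at hy' hj₁
  subst hj hj₁
  field_simp
  rw [hz]
  ring

/-- A rational parametrization of the quartic curve relating `w₁` and `w₂`. -/
lemma exists_parametrization_of_quartic (w₁ w₂ : ℂ)
    (hrel : w₁ ^ 4 - 4 * w₁ ^ 3 * w₂ + 6 * w₁ ^ 2 * w₂ - 4 * w₁ * w₂ + w₂ ^ 2 = 0)
    (hw0 : w₁ ≠ 0) (hw1 : w₁ ≠ 1) :
    ∃ r : ℂ, r ≠ 0 ∧ w₁ = -((r - 3) * (r + 1)) / (4 * r) ∧
      w₂ = -((r - 3) ^ 3 * (r + 1)) / (16 * r ^ 3) := by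
  have hw1' : w₁ - 1 ≠ 0 := sub_ne_zero.mpr hw1
  obtain ⟨r, hr⟩ : ∃ r : ℂ,
      w₂ = 2 * w₁ ^ 3 - 3 * w₁ ^ 2 + 2 * w₁ + w₁ * (w₁ - 1) * (2 * w₁ + r - 1) :=
    ⟨(w₂ - (2 * w₁ ^ 3 - 3 * w₁ ^ 2 + 2 * w₁)) / (w₁ * (w₁ - 1)) - 2 * w₁ + 1, by
      field_simp
      ring⟩
  have hconic : w₁ * (4 * r) = -((r - 3) * (r + 1)) := by
    have h : (w₁ * (w₁ - 1)) ^ 2 * (w₁ * (4 * r) - -((r - 3) * (r + 1))) = 0 := by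
      rw [hr] at hrel
      linear_combination hrel
    exact sub_eq_zero.mp
      ((mul_eq_zero.mp h).resolve_left (pow_ne_zero 2 (mul_ne_zero hw0 hw1')))
  have hr0 : r ≠ 0 := by
    rintro rfl
    norm_num at hconic
  have hw : w₁ = -((r - 3) * (r + 1)) / (4 * r) := by
    rw [← hconic]
    field_simp
  refine ⟨r, hr0, hw, ?_⟩
  rw [hr, hw]
  field_simp
  ring


/-- the cubic relation over `ℚ[j]` satisfied by the j-invariant `j₁`
of the elliptic subcover in the degenerate degree 3 case. -/
theorem stmt_5 (w₁ w₂ : ℂ)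
    (hrel : w₁ ^ 4 - 4 * w₁ ^ 3 * w₂ + 6 * w₁ ^ 2 * w₂ - 4 * w₁ * w₂ + w₂ ^ 2 = 0)
    (hw0 : w₁ ≠ 0) (hw1 : w₁ ≠ 1)
    (h1 : 4 * w₁ ^ 3 - 6 * w₁ ^ 2 + 3 * w₁ - w₂ ≠ 0)
    (h2 : 4 * w₁ ^ 3 - 3 * w₁ ^ 2 - w₂ ≠ 0)
    (h3 : 4 * w₁ ^ 3 - 9 * w₁ ^ 2 + 6 * w₁ - w₂ ≠ 0)
    (w₃ : ℂ)
    (hw₃ : w₃ = (4 * w₁ ^ 3 - 7 * w₁ ^ 2 + 4 * w₁ - w₂) ^ 3 * (4 * w₁ ^ 3 - 3 * w₁ ^ 2 - w₂)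
      / (16 * w₁ ^ 3 * (w₁ - 1) ^ 3 * (4 * w₁ ^ 3 - 6 * w₁ ^ 2 + 3 * w₁ - w₂)))
    (s : ℂ)
    (hs : s = -27 * (w₁ * (w₁ - 1) * (4 * w₁ ^ 3 - 7 * w₁ ^ 2 + 4 * w₁ - w₂)
        * (4 * w₁ ^ 3 - 5 * w₁ ^ 2 + 2 * w₁ - w₂)
      / ((4 * w₁ ^ 3 - 9 * w₁ ^ 2 + 6 * w₁ - w₂) * (4 * w₁ ^ 3 - 3 * w₁ ^ 2 - w₂)
        * (4 * w₁ ^ 3 - 6 * w₁ ^ 2 + 3 * w₁ - w₂))) ^ 2)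
    (hs0 : s ≠ 0) (hs1 : s ≠ 1)
    (h12 : w₁ ≠ w₂) (h13 : w₁ ≠ w₃) (h23 : w₂ ≠ w₃)
    (j₁ : ℂ) (hj₁ : j₁ = 256 * (s ^ 2 - s + 1) ^ 3 / (s ^ 2 * (s - 1) ^ 2))
    (μ : ℂ) (hμ : μ = (w₃ - w₁) / (w₂ - w₁))
    (j : ℂ) (hj : j = 256 * (μ ^ 2 - μ + 1) ^ 3 / (μ ^ 2 * (μ - 1) ^ 2))
    (A B C D : ℂ)
    (hA : A = (9 * j - 35152) ^ 4)
    (hB : B = -2187 * j ^ 7 + 38996640 * j ^ 6 - 277882258176 * j ^ 5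
      + 998642127618048 * j ^ 4 - 1868045010870009856 * j ^ 3
      + 1669509508048367910912 * j ^ 2 - 543484034691057422696448 * j
      + 16612482057244821172518912)
    (hC : C = 27 * j ^ 8 + 1125216 * j ^ 7 + 9650655872 * j ^ 6
      - 31593875152896 * j ^ 5 + 27748804997283840 * j ^ 4
      + 1114515284358510673920 * j ^ 3 - 6061989956030939246100480 * j ^ 2
      + 8346397859247767524611194880 * j + 353019691006036487376293855232)
    (hD : D = (j ^ 3 + 33120 * j ^ 2 + 290490624 * j - 310747594752) ^ 3) :
    256 * A * j₁ ^ 3 + 3 * B * j₁ ^ 2 + 6 * C * j₁ - D = 0 := by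
  obtain ⟨r, hr, hw₁, hw₂⟩ := exists_parametrization_of_quartic w₁ w₂ hrel hw0 hw1
  have ek1 : 4 * w₁ ^ 3 - 6 * w₁ ^ 2 + 3 * w₁ - w₂ =
      -((r - 1) * (r - 3) * (r + 1) * (r + 3)) / (16 * r) := by
    rw [hw₁, hw₂]
    field_simp
    ring
  have ek2 : 4 * w₁ ^ 3 - 3 * w₁ ^ 2 - w₂ =
      -((r - 1) * (r - 3) * (r + 1) * (r + 3) * (r - 3)) / (16 * r ^ 2) := by
    rw [hw₁, hw₂]
    field_simp
    ring
  have ek3 : 4 * w₁ ^ 3 - 9 * w₁ ^ 2 + 6 * w₁ - w₂ =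
      -((r - 1) * (r - 3) * (r + 1) * (r + 3) * (r + 3)) / (16 * r ^ 2) := by
    rw [hw₁, hw₂]
    field_simp
    ring
  have ek7 : 4 * w₁ ^ 3 - 7 * w₁ ^ 2 + 4 * w₁ - w₂ =
      -((r - 1) * (r - 3) * (r + 1) * (r + 3) * (r + 1)) / (16 * r ^ 2) := by
    rw [hw₁, hw₂]
    field_simp
    ring
  have ek5 : 4 * w₁ ^ 3 - 5 * w₁ ^ 2 + 2 * w₁ - w₂ =
      -((r - 1) * (r - 3) * (r + 1) * (r + 3) * (r - 1)) / (16 * r ^ 2) := by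
    rw [hw₁, hw₂]
    field_simp
    ring
  have ew : w₁ - 1 = -((r - 1) * (r + 3)) / (4 * r) := by
    rw [hw₁]
    field_simp
    ring
  rw [ek1] at h1
  have hr1 : r - 1 ≠ 0 := by intro h; simp [h] at h1
  have hr2 : r - 3 ≠ 0 := by intro h; simp [h] at h1
  have hr3 : r + 1 ≠ 0 := by intro h; simp [h] at h1
  have hr4 : r + 3 ≠ 0 := by intro h; simp [h] at h1
  have hw₃r : w₃ = -((r - 3) * (r + 1) ^ 3) / (16 * r) := by
    rw [hw₃, ek7, ek2, ek1, ew, hw₁]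
    field_simp
    ring
  have hw31 : w₃ - w₁ = -((r - 1) * (r - 3) * (r + 1) * (r + 3)) / (16 * r) := by
    rw [hw₃r, hw₁]
    field_simp
    ring
  have hw21 : w₂ - w₁ = 3 * ((r - 1) * (r - 3) * (r + 1) * (r + 3)) / (16 * r ^ 3) := by
    rw [hw₁, hw₂]
    field_simp
    ring
  have hμr : μ = -r ^ 2 / 3 := by
    rw [hμ, hw31, hw21]
    field_simp
  have e3 : μ + 3 = -((r - 3) * (r + 3)) / 3 := by rw [hμr]; ring
  have e13 : 3 * μ + 1 = -((r - 1) * (r + 1)) := by rw [hμr]; ring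
  have hμ0 : μ ≠ 0 := by simp [hμr, hr]
  have hμ3 : μ + 3 ≠ 0 := by simp [e3, hr2, hr4]
  have hμ13 : 3 * μ + 1 ≠ 0 := by
    rw [e13]
    exact neg_ne_zero.mpr (mul_ne_zero hr1 hr3)
  have hsμ : s = (3 * μ + 1) ^ 2 / (μ * (μ + 3) ^ 2) := by
    rw [hs, e3, e13, hμr, ek7, ek5, ek3, ek2, ek1, ew, hw₁]
    field_simp
    ring
  have hs1' : s - 1 = -(μ - 1) ^ 3 / (μ * (μ + 3) ^ 2) := by
    rw [hsμ]
    field_simp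
    ring
  have hμ1 : μ - 1 ≠ 0 := by
    intro h
    exact hs1 (sub_eq_zero.mp (by rw [hs1', h]; simp))
  have hy : (μ - 1) ^ 2 / μ ≠ 0 := div_ne_zero (pow_ne_zero 2 hμ1) hμ0
  have hy' : 3 * ((μ - 1) ^ 2 / μ) + 16 = (μ + 3) * (3 * μ + 1) / μ := by
    field_simp
    ring
  rw [hA, hB, hC, hD]
  refine cubic_relation_of_parametrization ((μ - 1) ^ 2 / μ) hy ?_ j j₁ ?_ ?_
  · rw [hy']
    exact div_ne_zero (mul_ne_zero hμ3 hμ13) hμ0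
  · rw [hj]
    field_simp
    ring
  · rw [hj₁, hs1', hsμ, hy']
    field_simp
    ring
end

section
/- Let q ∈ ℂ with q ∉ {0, 1, 1/2}. Define w₁ = -q(q-2)/(2q-1), w₂ = -q^3(q-2)/(2q-1), w₃ = -q(q^3 - 6q^2 + 12q - 8)/(2q-1)^3, k₂ = (2q-1)^3/(27q^2(q-1)^2), and s = -(1/27)·(2q-1)^2·(q-2)·(q^3 - 3q - 2)/(q^2(q-1)^2). Then there exists p ∈ ℂ such that the following identities hold in ℂ[X]: (i) k₂·(X - w₁)^3 - s·X·(X-1) = k₂·(X - w₂)·(X - p)^2; (ii) k₂·(X - w₁)^3 - X·(X-1) = k₂·(X - w₃)·(X - q)^2. -/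
open Polynomial

/-- the complementary degenerate degree 3 Frey-Kani covering
`φ₂(x) = k₂(x - w₁)³/(x(x-1))` parameterized by `q`. -/
theorem stmt_10 (q : ℂ) (hq0 : q ≠ 0) (hq1 : q ≠ 1) (hq2 : q ≠ 1/2)
    (w₁ w₂ w₃ k₂ s : ℂ)
    (hw₁ : w₁ = -(q * (q - 2)) / (2 * q - 1))
    (hw₂ : w₂ = -(q ^ 3 * (q - 2)) / (2 * q - 1))
    (hw₃ : w₃ = -(q * (q ^ 3 - 6 * q ^ 2 + 12 * q - 8)) / (2 * q - 1) ^ 3)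
    (hk₂ : k₂ = (2 * q - 1) ^ 3 / (27 * q ^ 2 * (q - 1) ^ 2))
    (hs : s = -(1/27) * (2 * q - 1) ^ 2 * (q - 2) * (q ^ 3 - 3 * q - 2)
      / (q ^ 2 * (q - 1) ^ 2)) :
    ∃ p : ℂ,
      (C k₂ * (X - C w₁) ^ 3 - C s * (X * (X - 1))
        = C k₂ * ((X - C w₂) * (X - C p) ^ 2)) ∧
      (C k₂ * (X - C w₁) ^ 3 - X * (X - 1)
        = C k₂ * ((X - C w₃) * (X - C q) ^ 2)) := by
  have hd : 2 * q - 1 ≠ 0 := fun h => hq2 (by linear_combination h / 2)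
  have hq1' : q - 1 ≠ 0 := sub_ne_zero.mpr hq1
  subst hw₁ hw₂ hw₃ hk₂ hs
  refine ⟨(q - 2) / (2 * q - 1), ?_, ?_⟩ <;>
  · refine Polynomial.funext fun x => ?_
    simp only [eval_sub, eval_mul, eval_pow, eval_C, eval_X, eval_one]
    field_simp
    ring
end

section
/- Let q = (1 + √3)/2 ∈ ℂ (or q = (1 - √3)/2), and define w₁ = -q(q-2)/(2q-1), w₂ = -q^3(q-2)/(2q-1), w₃ = -q(q^3 - 6q^2 + 12q - 8)/(2q-1)^3, and s = -(1/27)·(2q-1)^2·(q-2)·(q^3 - 3q - 2)/(q^2(q-1)^2). Then w₁ + w₂ + w₃ = 3/2, w₁w₂ + w₁w₃ + w₂w₃ = 9/16, w₁w₂w₃ = 1/32, and s = -1. In other words, for t = 1/2 the three points w₁, w₂, w₃ are exactly the roots of X^3 - (3/2)X^2 + (9/16)X - t/16, and the complementary elliptic subcover is E₂: y^2 = z(z-1)(z+1). -/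
/-- for `q = (1 ± √3)/2`, the points `w₁, w₂, w₃` are exactly the
roots of `X³ - (3/2)X² + (9/16)X - (1/2)/16` (i.e. `t = 1/2`), and the complementary
Legendre parameter is `s = -1`, so `E₂ : y² = z(z-1)(z+1)`. -/
theorem stmt_11 (q : ℂ)
    (hq : q = (1 + Real.sqrt 3) / 2 ∨ q = (1 - Real.sqrt 3) / 2)
    (w₁ w₂ w₃ s : ℂ)
    (hw₁ : w₁ = -(q * (q - 2)) / (2 * q - 1))
    (hw₂ : w₂ = -(q ^ 3 * (q - 2)) / (2 * q - 1))
    (hw₃ : w₃ = -(q * (q ^ 3 - 6 * q ^ 2 + 12 * q - 8)) / (2 * q - 1) ^ 3)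
    (hs : s = -(1/27) * (2 * q - 1) ^ 2 * (q - 2) * (q ^ 3 - 3 * q - 2)
      / (q ^ 2 * (q - 1) ^ 2)) :
    w₁ + w₂ + w₃ = 3/2
    ∧ w₁ * w₂ + w₁ * w₃ + w₂ * w₃ = 9/16
    ∧ w₁ * w₂ * w₃ = 1/32
    ∧ s = -1 := by
  have hsqrt : ((Real.sqrt 3 : ℝ) : ℂ) ^ 2 = 3 := by
    exact_mod_cast Real.sq_sqrt (show (0 : ℝ) ≤ 3 by norm_num)
  have hq2 : q ^ 2 = q + 1 / 2 := by
    rcases hq with rfl | rfl <;> linear_combination hsqrt / 4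
  have hsq : (2 * q - 1) ^ 2 = 3 := by linear_combination 4 * hq2
  have hne : 2 * q - 1 ≠ 0 := by
    intro h
    norm_num [h] at hsq
  have h₁ : w₁ = 1 / 2 := by
    rw [hw₁, div_eq_iff hne]
    linear_combination -hq2
  have h₂ : w₂ = q / 2 + 1 / 4 := by
    rw [hw₂, div_eq_iff hne]
    linear_combination (-q ^ 2 + q - 1 / 2) * hq2
  have h₃ : w₃ = 3 / 4 - q / 2 := by
    have hcube : (2 * q - 1) ^ 3 = 3 * (2 * q - 1) := by
      linear_combination (2 * q - 1) * hsq
    rw [hw₃, hcube, div_eq_iff (mul_ne_zero three_ne_zero hne)]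
    linear_combination (-q ^ 2 + 5 * q - 9 / 2) * hq2
  have hden : q ^ 2 * (q - 1) ^ 2 = 1 / 4 := by
    linear_combination (q ^ 2 - q + 1 / 2) * hq2
  have hnum : (q - 2) * (q ^ 3 - 3 * q - 2) = 9 / 4 := by
    linear_combination (q ^ 2 - q - 7 / 2) * hq2
  refine ⟨?_, ?_, ?_, ?_⟩
  · rw [h₁, h₂, h₃]
    ring
  · rw [h₁, h₂, h₃]
    linear_combination -hq2 / 4
  · rw [h₁, h₂, h₃]
    linear_combination -hq2 / 8
  · rw [hs, mul_assoc, hnum, hsq, hden]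
    norm_num
end

section
/- Let t₁ = (241 + 22i√2)/(-2 + 22i√2) ∈ ℂ and t₂ = (241 + 22i√2)/243 ∈ ℂ. Then 256(t₁^2 - t₁ + 1)^3/(t₁^2(t₁ - 1)^2) = -873722816/59049 and 256(t₂^2 - t₂ + 1)^3/(t₂^2(t₂ - 1)^2) = -873722816/59049; that is, the Legendre elliptic curves y^2 = z(z-1)(z - t₁) and y^2 = z(z-1)(z - t₂) have the same j-invariant -873722816/59049, and in particular are isomorphic over ℂ. -/
/-- the Legendre parameters `t₁ = (241 + 22i√2)/(-2 + 22i√2)` and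
`t₂ = (241 + 22i√2)/243` yield the same j-invariant `-873722816/59049`. -/
theorem stmt_12 (t₁ t₂ : ℂ)
    (ht₁ : t₁ = (241 + 22 * Complex.I * Real.sqrt 2) / (-2 + 22 * Complex.I * Real.sqrt 2))
    (ht₂ : t₂ = (241 + 22 * Complex.I * Real.sqrt 2) / 243) :
    256 * (t₁ ^ 2 - t₁ + 1) ^ 3 / (t₁ ^ 2 * (t₁ - 1) ^ 2) = -873722816 / 59049
    ∧ 256 * (t₂ ^ 2 - t₂ + 1) ^ 3 / (t₂ ^ 2 * (t₂ - 1) ^ 2) = -873722816 / 59049 := by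
  have hw : (Complex.I * (Real.sqrt 2 : ℂ)) ^ 2 = -2 := by
    rw [mul_pow, Complex.I_sq, ← Complex.ofReal_pow, Real.sq_sqrt zero_le_two]
    norm_num
  rw [mul_assoc] at ht₁ ht₂
  generalize Complex.I * (Real.sqrt 2 : ℂ) = w at hw ht₁ ht₂
  have hd : -2 + 22 * w ≠ 0 := by
    intro h
    have : (972 : ℂ) = 0 := by linear_combination (-2 - 22 * w) * h + 484 * hw
    norm_num at this
  have h₁ : t₁ = (1 - 11 * w) / 2 := by
    rw [ht₁, div_eq_iff hd]
    linear_combination 121 * hw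
  have hq₁ : t₁ ^ 2 - t₁ = -243 / 4 := by
    rw [h₁]
    linear_combination 121 / 4 * hw
  have hq₂ : t₂ ^ 2 = 482 / 243 * t₂ - 1 := by
    rw [ht₂]
    linear_combination 484 / 59049 * hw
  have ht₂_ne : t₂ ≠ 0 := by
    rintro rfl
    norm_num at hq₂
  constructor
  · rw [← mul_pow, show t₁ * (t₁ - 1) = -243 / 4 by linear_combination hq₁, hq₁]
    norm_num
  · have hnum : t₂ ^ 2 - t₂ + 1 = 239 / 243 * t₂ := by linear_combination hq₂
    have hden : (t₂ - 1) ^ 2 = -4 / 243 * t₂ := by linear_combination hq₂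
    rw [hnum, hden]
    field_simp
    norm_num
end

section
/- Let u, v ∈ ℂ satisfy 15u^4 - 82u^3 - 8v·u^2 + 159u^2 - 140u + 56v·u - 16v^2 - 52v + 50 = 0, and assume 2u - 3 ≠ 0, 6u^2 - 10u + 5 - 8v ≠ 0 and u^2 - 4v ≠ 0. Define d = (3u^2 - 4u - 4v + 1)^2/((2u-3)(6u^2 - 10u + 5 - 8v)), w = -(u^2 - 6u + 4v + 5)(u^2 - 4v)/(8(2u-3)), and t = (u^2 - 4v)·(-8u^4 + 24u^3 + 63u^2 + 64v^2 - 192uv + 196v + 16u^2·v - 180u + 100)/((2u-3)(6u^2 - 10u + 5 - 8v)). Then there exist k, a, b, a₁, b₁, p ∈ ℂ with k ≠ 0 such that the following identities hold in ℂ[X]: (i) k·X·(X^2 - a·X + b)^2 - (X - d) = k·(X - 1)·(X^2 - a₁·X + b₁)^2; (ii) k·X·(X^2 - a·X + b)^2 - t·(X - d) = k·(X^3 - u·X^2 + v·X - w)·(X - p)^2. -/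
open Polynomial

/-- existence of a degree 5 Frey-Kani covering of ramification
type II,iii for the genus 2 curve `Y² = x(x-1)(x-d)(x³-ux²+vx-w)` over the
elliptic curve `y² = z(z-1)(z-t)`. -/
theorem stmt_13 (u v : ℂ)
    (hrel : 15 * u ^ 4 - 82 * u ^ 3 - 8 * v * u ^ 2 + 159 * u ^ 2 - 140 * u
      + 56 * v * u - 16 * v ^ 2 - 52 * v + 50 = 0)
    (h1 : 2 * u - 3 ≠ 0) (h2 : 6 * u ^ 2 - 10 * u + 5 - 8 * v ≠ 0)
    (h3 : u ^ 2 - 4 * v ≠ 0)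
    (d w t : ℂ)
    (hd : d = (3 * u ^ 2 - 4 * u - 4 * v + 1) ^ 2
      / ((2 * u - 3) * (6 * u ^ 2 - 10 * u + 5 - 8 * v)))
    (hw : w = -((u ^ 2 - 6 * u + 4 * v + 5) * (u ^ 2 - 4 * v)) / (8 * (2 * u - 3)))
    (ht : t = (u ^ 2 - 4 * v)
      * (-8 * u ^ 4 + 24 * u ^ 3 + 63 * u ^ 2 + 64 * v ^ 2 - 192 * u * v
        + 196 * v + 16 * u ^ 2 * v - 180 * u + 100)
      / ((2 * u - 3) * (6 * u ^ 2 - 10 * u + 5 - 8 * v))) :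
    ∃ k a b a₁ b₁ p : ℂ, k ≠ 0 ∧
      (C k * (X * (X ^ 2 - C a * X + C b) ^ 2) - (X - C d)
        = C k * ((X - 1) * (X ^ 2 - C a₁ * X + C b₁) ^ 2)) ∧
      (C k * (X * (X ^ 2 - C a * X + C b) ^ 2) - C t * (X - C d)
        = C k * ((X ^ 3 - C u * X ^ 2 + C v * X - C w) * (X - C p) ^ 2)) := by
  obtain ⟨c, hc⟩ : ∃ c : ℂ, c * (2 * u - 3) = 6 * u ^ 2 - 10 * u + 5 - 8 * v :=
    ⟨_, div_mul_cancel₀ _ h1⟩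
  have hc0 : c ≠ 0 := fun h => h2 (by rw [← hc, h, zero_mul])
  have hv : v = (6 * u ^ 2 - 10 * u + 5 - c * (2 * u - 3)) / 8 := by
    linear_combination hc / 8
  have hquad : 8 * c * u = c ^ 2 + 12 * c - 5 := by
    have h : (2 * u - 3) ^ 2 * (8 * c * u - (c ^ 2 + 12 * c - 5)) = 0 := by
      rw [hv] at hrel
      linear_combination 4 * hrel
    exact sub_eq_zero.mp ((mul_eq_zero.mp h).resolve_left (pow_ne_zero 2 h1))
  have hu : u = (c ^ 2 + 12 * c - 5) / (8 * c) := by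
    rw [eq_div_iff (by simpa using hc0)]; linear_combination hquad
  have hs : 2 * u - 3 = (c ^ 2 - 5) / (4 * c) := by
    rw [hu]; field_simp; ring
  have hq : c ^ 2 - 5 ≠ 0 := fun h => h1 (by rw [hs, h, zero_div])
  rw [← hc, hs, hv, hu] at hd ht
  rw [hs, hv, hu] at hw
  rw [hs, hu] at hv
  clear hs hquad hrel hc h1 h2 h3
  have hd' : d = (c + 1) ^ 2 / (4 * c) := by
    rw [hd]; field_simp; ring
  refine ⟨-64 / c, (c + 5) / 4, (3 * c + 5) / 16, (c + 3) / 4, (c + 1) / 16,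
    (c + 5) / 4 - u / 2, by simpa using hc0, ?_, ?_⟩
  all_goals
    apply Polynomial.funext
    intro x
    simp only [eval_mul, eval_sub, eval_add, eval_pow, eval_C, eval_X, eval_one]
  · rw [hd']; field_simp; ring
  · rw [hd', ht, hw, hv, hu]
    field_simp
    ring
end

section
/- Let t, d ∈ ℂ with d ∉ {0, 1}, t ∉ {0, 1}, d being such that 90d^4·t^2 - 36d^7·t - 9t^2·d - 84t^2·d^3 + 36t^2·d^2 + t^3 - d^9 + 36t·d^4 - 90t·d^5 + 84t·d^6 + 9t·d^8 - 36d^5·t^2 ≠ 0 and 168t·d^6 - t^2 - 168t·d^5 - 20t·d^3 + 6t^2·d - 10t^2·d^2 + 5t^2·d^3 + 90t·d^4 - 90d^7·t + 20t·d^8 - 6d^10 + d^11 + 10d^9 - 5d^8 ≠ 0. Suppose there exist k ∈ ℂ with k ≠ 0, a, b, c ∈ ℂ, and monic cubic polynomials P₁, P₂, P₃ ∈ ℂ[X] such that, with f(X) = X^3 - a·X^2 + b·X - c, the identities k·X·P₁(X)^2 - f(X) = k·(X - 1)·P₂(X)^2 and k·X·P₁(X)^2 - t·f(X) = k·(X -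 d)·P₃(X)^2 hold in ℂ[X], and such that f(0) ≠ 0, f(1) ≠ 0 and f(d) ≠ 0. Then t and d satisfy d^16 - 16(t·d^15 + t^3·d) + 120t·d^14 - 560t·d^13 + (400t^2 + 1420t)·d^12 - (2400t^2 + 1968t)·d^11 + (6608t^2 + 1400t)·d^10 - (11040t^2 + 400t)·d^9 + 12870t^2·d^8 - (400t^3 + 11040t^2)·d^7 + 120t^3·d^2 + (1400t^3 + 6608t^2)·d^6 - (1968t^3 + 2400t^2)·d^5 + (1420t^3 + 400t^2)·d^4 - 560t^3·d^3 + t^4 = 0. -/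
open Polynomial

/-- The resultant in `α` of a quartic and a cubic that is linear in `t`. -/
theorem eliminate_subleading_coeff {t d α : ℂ}
    (hB : 144 * α ^ 4 + 672 * α ^ 3 * d + 672 * α ^ 3 + 1008 * α ^ 2 * d ^ 2 + 2520 * α ^ 2 * d
      + 1008 * α ^ 2 + 480 * α * d ^ 3 + 2808 * α * d ^ 2 + 2808 * α * d + 480 * α + 840 *
      d ^ 3 + 1785 * d ^ 2 + 840 * d = 0)
    (hL : -48 * α ^ 3 * d + 48 * α ^ 3 * t - 188 * α ^ 2 * d ^ 2 + 128 * α ^ 2 * d * t - 128 *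
      α ^ 2 * d + 188 * α ^ 2 * t - 220 * α * d ^ 3 + 80 * α * d ^ 2 * t - 368 * α * d ^ 2
      + 368 * α * d * t - 80 * α * d + 220 * α * t - 70 * d ^ 4 - 245 * d ^ 3 + 140 * d ^ 2
      * t - 140 * d ^ 2 + 245 * d * t + 70 * t = 0) :
    d ^ 16 - 16 * (t * d ^ 15 + t ^ 3 * d) + 120 * t * d ^ 14 - 560 * t * d ^ 13
      + (400 * t ^ 2 + 1420 * t) * d ^ 12 - (2400 * t ^ 2 + 1968 * t) * d ^ 11
      + (6608 * t ^ 2 + 1400 * t) * d ^ 10 - (11040 * t ^ 2 + 400 * t) * d ^ 9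
      + 12870 * t ^ 2 * d ^ 8 - (400 * t ^ 3 + 11040 * t ^ 2) * d ^ 7
      + 120 * t ^ 3 * d ^ 2 + (1400 * t ^ 3 + 6608 * t ^ 2) * d ^ 6
      - (1968 * t ^ 3 + 2400 * t ^ 2) * d ^ 5
      + (1420 * t ^ 3 + 400 * t ^ 2) * d ^ 4 - 560 * t ^ 3 * d ^ 3 + t ^ 4 = 0 := by
  linear_combination
    (-12/7 * α ^ 3 * d ^ 9 + 108/7 * α ^ 3 * d ^ 8 * t - 432/7 * α ^ 3 * d ^ 7 * t + 144 *
      α ^ 3 * d ^ 6 * t - 432/7 * α ^ 3 * d ^ 5 * t ^ 2 - 1080/7 * α ^ 3 * d ^ 5 * t +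
      1080/7 * α ^ 3 * d ^ 4 * t ^ 2 + 432/7 * α ^ 3 * d ^ 4 * t - 144 * α ^ 3 * d ^ 3 * t
      ^ 2 + 432/7 * α ^ 3 * d ^ 2 * t ^ 2 - 108/7 * α ^ 3 * d * t ^ 2 + 12/7 * α ^ 3 * t ^
      3 - 5 * α ^ 2 * d ^ 10 + 48 * α ^ 2 * d ^ 9 * t - 8 * α ^ 2 * d ^ 9 - 135 * α ^ 2 * d
      ^ 8 * t + 240 * α ^ 2 * d ^ 7 * t - 228 * α ^ 2 * d ^ 6 * t ^ 2 + 18 * α ^ 2 * d ^ 6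
      * t + 360 * α ^ 2 * d ^ 5 * t ^ 2 - 360 * α ^ 2 * d ^ 5 * t - 18 * α ^ 2 * d ^ 4 * t
      ^ 2 + 228 * α ^ 2 * d ^ 4 * t - 240 * α ^ 2 * d ^ 3 * t ^ 2 + 135 * α ^ 2 * d ^ 2 * t
      ^ 2 + 8 * α ^ 2 * d * t ^ 3 - 48 * α ^ 2 * d * t ^ 2 + 5 * α ^ 2 * t ^ 3 - 17/5 * α *
      d ^ 11 + 172/5 * α * d ^ 10 * t - 16 * α * d ^ 10 - 4 * α * d ^ 9 * t - 12 * α * d ^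
      9 - 123 * α * d ^ 8 * t - 212 * α * d ^ 7 * t ^ 2 + 686 * α * d ^ 7 * t - 56 * α * d
      ^ 6 * t ^ 2 - 3836/5 * α * d ^ 6 * t + 3836/5 * α * d ^ 5 * t ^ 2 + 56 * α * d ^ 5 *
      t - 686 * α * d ^ 4 * t ^ 2 + 212 * α * d ^ 4 * t + 123 * α * d ^ 3 * t ^ 2 + 12 * α
      * d ^ 2 * t ^ 3 + 4 * α * d ^ 2 * t ^ 2 + 16 * α * d * t ^ 3 - 172/5 * α * d * t ^ 2
      + 17/5 * α * t ^ 3 - 1/70 * d ^ 12 + 8/35 * d ^ 11 * t - 837/140 * d ^ 11 + 2063/35 *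
      d ^ 10 * t - 87/7 * d ^ 10 - 4251/28 * d ^ 9 * t - 40/7 * d ^ 9 - 40/7 * d ^ 8 * t ^
      2 + 4007/14 * d ^ 8 * t - 2437/7 * d ^ 7 * t ^ 2 + 7177/70 * d ^ 7 * t + 20214/35 * d
      ^ 6 * t ^ 2 - 20214/35 * d ^ 6 * t - 7177/70 * d ^ 5 * t ^ 2 + 2437/7 * d ^ 5 * t -
      4007/14 * d ^ 4 * t ^ 2 + 40/7 * d ^ 4 * t + 40/7 * d ^ 3 * t ^ 3 + 4251/28 * d ^ 3 *
      t ^ 2 + 87/7 * d ^ 2 * t ^ 3 - 2063/35 * d ^ 2 * t ^ 2 + 837/140 * d * t ^ 3 - 8/35 *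
      d * t ^ 2 + 1/70 * t ^ 3) * hL
    + (-4/7 * α ^ 2 * d ^ 10 + 40/7 * α ^ 2 * d ^ 9 * t - 36/7 * α ^ 2 * d ^ 8 * t ^ 2 -
      144/7 * α ^ 2 * d ^ 8 * t + 144/7 * α ^ 2 * d ^ 7 * t ^ 2 + 48 * α ^ 2 * d ^ 7 * t -
      480/7 * α ^ 2 * d ^ 6 * t ^ 2 - 360/7 * α ^ 2 * d ^ 6 * t + 144/7 * α ^ 2 * d ^ 5 * t
      ^ 3 + 720/7 * α ^ 2 * d ^ 5 * t ^ 2 + 144/7 * α ^ 2 * d ^ 5 * t - 360/7 * α ^ 2 * d ^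
      4 * t ^ 3 - 480/7 * α ^ 2 * d ^ 4 * t ^ 2 + 48 * α ^ 2 * d ^ 3 * t ^ 3 + 144/7 * α ^
      2 * d ^ 3 * t ^ 2 - 144/7 * α ^ 2 * d ^ 2 * t ^ 3 - 36/7 * α ^ 2 * d ^ 2 * t ^ 2 +
      40/7 * α ^ 2 * d * t ^ 3 - 4/7 * α ^ 2 * t ^ 4 - 26/21 * α * d ^ 11 + 38/3 * α * d ^
      10 * t - 32/21 * α * d ^ 10 - 40/7 * α * d ^ 9 * t ^ 2 - 790/21 * α * d ^ 9 * t +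
      54/7 * α * d ^ 8 * t ^ 2 + 596/7 * α * d ^ 8 * t - 60 * α * d ^ 7 * t ^ 2 - 360/7 * α
      * d ^ 7 * t + 244/7 * α * d ^ 6 * t ^ 3 + 348/7 * α * d ^ 6 * t ^ 2 - 228/7 * α * d ^
      6 * t - 228/7 * α * d ^ 5 * t ^ 3 + 348/7 * α * d ^ 5 * t ^ 2 + 244/7 * α * d ^ 5 * t
      - 360/7 * α * d ^ 4 * t ^ 3 - 60 * α * d ^ 4 * t ^ 2 + 596/7 * α * d ^ 3 * t ^ 3 +
      54/7 * α * d ^ 3 * t ^ 2 - 790/21 * α * d ^ 2 * t ^ 3 - 40/7 * α * d ^ 2 * t ^ 2 -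
      32/21 * α * d * t ^ 4 + 38/3 * α * d * t ^ 3 - 26/21 * α * t ^ 4 - 211/420 * d ^ 12 +
      538/105 * d ^ 11 * t - 12/7 * d ^ 11 - 4/105 * d ^ 10 * t ^ 2 - 251/42 * d ^ 10 * t -
      20/21 * d ^ 10 - 206/21 * d ^ 9 * t ^ 2 + 52/21 * d ^ 9 * t - 383/84 * d ^ 8 * t ^ 2
      + 421/6 * d ^ 8 * t + 20/21 * d ^ 7 * t ^ 3 - 106/3 * d ^ 7 * t ^ 2 - 1766/15 * d ^ 7
      * t + 173/3 * d ^ 6 * t ^ 3 + 1207/15 * d ^ 6 * t ^ 2 + 173/3 * d ^ 6 * t - 1766/15 *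
      d ^ 5 * t ^ 3 - 106/3 * d ^ 5 * t ^ 2 + 20/21 * d ^ 5 * t + 421/6 * d ^ 4 * t ^ 3 -
      383/84 * d ^ 4 * t ^ 2 + 52/21 * d ^ 3 * t ^ 3 - 206/21 * d ^ 3 * t ^ 2 - 20/21 * d ^
      2 * t ^ 4 - 251/42 * d ^ 2 * t ^ 3 - 4/105 * d ^ 2 * t ^ 2 - 12/7 * d * t ^ 4 +
      538/105 * d * t ^ 3 - 211/420 * t ^ 4) * hB

/-- A monic polynomial solution of the first integral of the symmetric square of the Lamé
equation is determined by its subleading coefficient `α`, which is a root of a quartic. -/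
theorem symmSquare_coeffs {d α β γ q₀ q₁ s : ℂ}
    (h : ∀ x : ℂ,
      4 * (x * ((x - 1) * (x - d))) * (4 * (x ^ 3 + α * x ^ 2 + β * x + γ)
            * (3 * x ^ 2 + 2 * α * x + β)
          + 2 * x * (3 * x ^ 2 + 2 * α * x + β) ^ 2
          + 2 * x * (x ^ 3 + α * x ^ 2 + β * x + γ) * (6 * x + 2 * α))
        + 2 * ((x - 1) * (x - d) + x * (x - d) + x * (x - 1))
          * ((x ^ 3 + α * x ^ 2 + β * x + γ) ^ 2
            + 2 * x * (x ^ 3 + α * x ^ 2 + β * x + γ) * (3 * x ^ 2 + 2 * α * x + β))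
        - 3 * ((x - 1) * (x - d)) * ((x ^ 3 + α * x ^ 2 + β * x + γ)
            + 2 * x * (3 * x ^ 2 + 2 * α * x + β)) ^ 2 + s
      = x * (x ^ 3 + α * x ^ 2 + β * x + γ) ^ 2 * (q₁ * x + q₀)) :
    32 * β = 20 * α ^ 2 + 20 * α * d + 20 * α + 35 * d ∧
    32 * γ = 12 * α ^ 3 + 32 * α ^ 2 * d + 32 * α ^ 2 + 20 * α * d ^ 2 + 77 * α * d
      + 20 * α + 35 * d ^ 2 + 35 * d ∧
    144 * α ^ 4 + 672 * α ^ 3 * d + 672 * α ^ 3 + 1008 * α ^ 2 * d ^ 2 + 2520 * α ^ 2 * d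
      + 1008 * α ^ 2 + 480 * α * d ^ 3 + 2808 * α * d ^ 2 + 2808 * α * d + 480 * α + 840 *
      d ^ 3 + 1785 * d ^ 2 + 840 * d = 0 := by
  obtain rfl : q₁ = 63 := by
    linear_combination (-1/40320) * h (-4) + (1/5040) * h (-3) + (-1/1440) * h (-2)
      + (1/720) * h (-1) + (-1/576) * h 0 + (1/720) * h 1 + (-1/1440) * h 2 + (1/5040) * h 3
      + (-1/40320) * h 4
  obtain rfl : q₀ = -24 * α - 49 * d - 49 := by
    linear_combination (1/10080) * h (-4) + (-1/1680) * h (-3) + (1/720) * h (-2)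
      + (-1/720) * h (-1) + (1/720) * h 1 + (-1/720) * h 2 + (1/1680) * h 3 + (-1/10080) * h 4
  obtain rfl : β = 5/8 * α ^ 2 + 5/8 * α * d + 5/8 * α + 35/32 * d := by
    linear_combination (1/92160) * h (-4) + (-1/7680) * h (-3) + (13/23040) * h (-2)
      + (-29/23040) * h (-1) + (5/3072) * h 0 + (-29/23040) * h 1 + (13/23040) * h 2
      + (-1/7680) * h 3 + (1/92160) * h 4
  obtain rfl : γ = 3/8 * α ^ 3 + α ^ 2 * d + α ^ 2 + 5/8 * α * d ^ 2 + 77/32 * α * d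
      + 5/8 * α + 35/32 * d ^ 2 + 35/32 * d := by
    linear_combination (-1/17280) * h (-4) + (1/1920) * h (-3) + (-13/8640) * h (-2)
      + (29/17280) * h (-1) + (-29/17280) * h 1 + (13/8640) * h 2 + (-1/1920) * h 3
      + (1/17280) * h 4
  refine ⟨by ring, by ring, ?_⟩
  linear_combination (7/90) * h (-4) + (-16/15) * h (-3) + (338/45) * h (-2)
    + (-976/45) * h (-1) + (91/3) * h 0 + (-976/45) * h 1 + (338/45) * h 2 + (-16/15) * h 3
    + (7/90) * h 4

/-- The order of contact at infinity of `x P(x)²` and `(x - e) Q(x)²`. -/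
theorem contact_coeff {e τ α β γ α' β' γ' a b c : ℂ}
    (h : ∀ x : ℂ, x * (x ^ 3 + α * x ^ 2 + β * x + γ) ^ 2
        - (x - e) * (x ^ 3 + α' * x ^ 2 + β' * x + γ') ^ 2
      = τ * (x ^ 3 - a * x ^ 2 + b * x - c)) :
    64 * τ = 35 * e ^ 4 + 40 * e ^ 3 * α + 48 * e ^ 2 * β + 64 * e * γ := by
  obtain rfl : α' = α + e / 2 := by
    linear_combination (-1/1440) * h (-3) + (1/240) * h (-2) + (-1/96) * h (-1) + (1/72) * h 0
      + (-1/96) * h 1 + (1/240) * h 2 + (-1/1440) * h 3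
  obtain rfl : β' = β + e / 2 * α + 3 * e ^ 2 / 8 := by
    linear_combination (1/480) * h (-3) + (-1/120) * h (-2) + (1/96) * h (-1) + (-1/96) * h 1
      + (1/120) * h 2 + (-1/480) * h 3
  obtain rfl : γ' = γ + e / 2 * β + 3 * e ^ 2 / 8 * α + 5 * e ^ 3 / 16 := by
    linear_combination (1/288) * h (-3) + (-1/24) * h (-2) + (13/96) * h (-1) + (-7/36) * h 0
      + (13/96) * h 1 + (-1/24) * h 2 + (1/288) * h 3
  linear_combination (-4/3) * h (-3) + (32/3) * h (-2) + (-52/3) * h (-1) + (52/3) * h 1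
    + (-32/3) * h 2 + (4/3) * h 3

theorem isCoprime_of_forall_not_common_root {p q : ℂ[X]}
    (h : ∀ r, p.eval r = 0 → q.eval r ≠ 0) : IsCoprime p q := by
  rw [← EuclideanDomain.gcd_isUnit_iff]
  by_contra hu
  rcases eq_or_ne (EuclideanDomain.gcd p q) 0 with h0 | h0
  · rw [EuclideanDomain.gcd_eq_zero_iff] at h0
    exact h 0 (by simp [h0.1]) (by simp [h0.2])
  · obtain ⟨r, hr⟩ := IsAlgClosed.exists_root (EuclideanDomain.gcd p q) (by
      intro hd
      exact hu (isUnit_iff_degree_eq_zero.2 hd))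
    exact h r (hr.dvd (EuclideanDomain.gcd_dvd_left p q))
      (hr.dvd (EuclideanDomain.gcd_dvd_right p q))

/-- If `u P²`, `v Q²` and `w R²` lie in the pencil spanned by `u P²` and `F`, then `P`, `Q` and `R`
divide the Wronskian of the pencil. -/
theorem mul_mul_dvd_pencil_wronskian {u v w P Q R F : ℂ[X]} {t : ℂ}
    (h₁ : u * P ^ 2 - v * Q ^ 2 = F) (h₂ : u * P ^ 2 - w * R ^ 2 = C t * F)
    (hPQ : IsCoprime P Q) (hPR : IsCoprime P R) (hQR : IsCoprime Q R) :
    P * Q * R ∣ derivative (u * P ^ 2) * F - u * P ^ 2 * derivative F := by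
  have key : ∀ z S : ℂ[X], S ∣ derivative (z * S ^ 2) * F - z * S ^ 2 * derivative F := by
    intro z S
    refine ⟨(derivative z * S + 2 * z * derivative S) * F - z * S * derivative F, ?_⟩
    simp only [derivative_mul, derivative_pow, Nat.cast_ofNat, map_ofNat]
    ring
  have hQ : Q ∣ derivative (u * P ^ 2) * F - u * P ^ 2 * derivative F := by
    convert key v Q using 1
    rw [eq_add_of_sub_eq h₁, derivative_add]
    ring
  have hR : R ∣ derivative (u * P ^ 2) * F - u * P ^ 2 * derivative F := by
    convert key w R using 1
    rw [eq_add_of_sub_eq h₂, derivative_add, derivative_C_mul]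
    ring
  exact (hPR.mul_left hQR).mul_dvd (hPQ.mul_dvd (key u P) hQ) hR

theorem exists_eq_cubic_of_monic {P : ℂ[X]} (hP : P.Monic) (hdeg : P.natDegree = 3) :
    ∃ α β γ : ℂ, P = X ^ 3 + C α * X ^ 2 + C β * X + C γ := by
  refine ⟨P.coeff 2, P.coeff 1, P.coeff 0, ?_⟩
  have h3 : P.coeff 3 = 1 := hdeg ▸ hP.coeff_natDegree
  conv_lhs => rw [P.as_sum_range_C_mul_X_pow, hdeg]
  simp only [Finset.sum_range_succ, Finset.range_zero, Finset.sum_empty, h3, map_one]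
  ring

/-- In a pencil of degree 7 with contact of order 4 at infinity, the three cubics have no common
root. -/
theorem no_common_root_of_pencil {t d κ a b c r : ℂ} {P Q R f : ℂ[X]} (ht0 : t ≠ 0) (ht1 : t ≠ 1)
    (hκ : κ ≠ 0)
    (hP : P.Monic) (hPdeg : P.natDegree = 3) (hQ : Q.Monic) (hQdeg : Q.natDegree = 3)
    (hR : R.Monic) (hRdeg : R.natDegree = 3)
    (hf : f = X ^ 3 - C a * X ^ 2 + C b * X - C c)
    (h₁ : X * P ^ 2 - (X - 1) * Q ^ 2 = C κ * f)
    (h₂ : X * P ^ 2 - (X - C d) * R ^ 2 = C t * (C κ * f))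
    (hPr : P.eval r = 0) (hQr : Q.eval r = 0) (hRr : R.eval r = 0) : False := by
  obtain ⟨P', rfl⟩ := dvd_iff_isRoot.2 hPr
  obtain ⟨Q', rfl⟩ := dvd_iff_isRoot.2 hQr
  obtain ⟨R', rfl⟩ := dvd_iff_isRoot.2 hRr
  have hX : (X - C r : ℂ[X]) ≠ 0 := X_sub_C_ne_zero r
  have hfdvd : (X - C r) ^ 2 ∣ f := by
    have : (X - C r) ^ 2 ∣ C κ * f := ⟨X * P' ^ 2 - (X - 1) * Q' ^ 2, by rw [← h₁]; ring⟩
    exact (IsUnit.dvd_mul_left (isUnit_C.2 hκ.isUnit)).1 this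
  obtain ⟨g, hg⟩ := hfdvd
  have hfm : f.Monic := by rw [hf]; monicity!
  have hfdeg : f.natDegree = 3 := by rw [hf]; compute_degree!
  have hgm : g.Monic := ((monic_X_sub_C r).pow 2).of_mul_monic_left (hg ▸ hfm)
  have hgdeg : g.natDegree = 1 := by
    have := ((monic_X_sub_C r).pow 2).natDegree_mul hgm
    rw [← hg, hfdeg, natDegree_pow, natDegree_X_sub_C] at this
    omega
  have monic_quot : ∀ S : ℂ[X], ((X - C r) * S).Monic → ((X - C r) * S).natDegree = 3 →
      S.Monic ∧ S.natDegree = 2 := by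
    intro S hS hSdeg
    have hm := (monic_X_sub_C r).of_mul_monic_left hS
    rw [(monic_X_sub_C r).natDegree_mul hm, natDegree_X_sub_C] at hSdeg
    exact ⟨hm, by omega⟩
  obtain ⟨hP', hP'deg⟩ := monic_quot P' hP hPdeg
  obtain ⟨hQ', hQ'deg⟩ := monic_quot Q' hQ hQdeg
  obtain ⟨hR', hR'deg⟩ := monic_quot R' hR hRdeg

  have h₁' : X * P' ^ 2 - (X - 1) * Q' ^ 2 = C κ * g := by
    refine mul_left_cancel₀ (pow_ne_zero 2 hX) ?_
    rw [hg] at h₁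
    linear_combination h₁
  have h₂' : X * P' ^ 2 - (X - C d) * R' ^ 2 = C t * (C κ * g) := by
    refine mul_left_cancel₀ (pow_ne_zero 2 hX) ?_
    rw [hg] at h₂
    linear_combination h₂
  have coprime : ∀ (e : ℂ) (u v U V : ℂ[X]), e ≠ 0 → u * U ^ 2 - v * V ^ 2 = C e * g →
      IsCoprime U V := by
    intro e u v U V he h
    refine isCoprime_of_forall_not_common_root fun s hU hV => ?_
    have hdvd : (X - C s) ^ 2 ∣ C e * g := h ▸ dvd_sub
      ((pow_dvd_pow_of_dvd (dvd_iff_isRoot.2 hU) 2).mul_left u)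
      ((pow_dvd_pow_of_dvd (dvd_iff_isRoot.2 hV) 2).mul_left v)
    have hle := natDegree_le_of_dvd ((IsUnit.dvd_mul_left (isUnit_C.2 he.isUnit)).1 hdvd)
      hgm.ne_zero
    rw [natDegree_pow, natDegree_X_sub_C, hgdeg] at hle
    omega
  have hdvd := mul_mul_dvd_pencil_wronskian h₁' h₂' (coprime κ _ _ _ _ hκ h₁')
    (coprime (t * κ) _ _ _ _ (mul_ne_zero ht0 hκ) (by rw [h₂', C_mul, mul_assoc]))
    (coprime ((t - 1) * κ) (X - 1) (X - C d) _ _ (mul_ne_zero (sub_ne_zero.2 ht1) hκ) (by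
      rw [C_mul, C_sub, C_1]
      linear_combination h₂' - h₁'))
  have hprod : (P' * Q' * R').natDegree = 6 := by
    rw [(hP'.mul hQ').natDegree_mul hR', hP'.natDegree_mul hQ', hP'deg, hQ'deg, hR'deg]
  have hP'eq : P' = X ^ 2 + C (P'.coeff 1) * X + C (P'.coeff 0) := by
    have h2 : P'.coeff 2 = 1 := hP'deg ▸ hP'.coeff_natDegree
    conv_lhs => rw [P'.as_sum_range_C_mul_X_pow, hP'deg]
    simp only [Finset.sum_range_succ, Finset.range_zero, Finset.sum_empty, h2, map_one]
    ring
  have hgeq : g = X + C (g.coeff 0) := by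
    have h2 : g.coeff 1 = 1 := hgdeg ▸ hgm.coeff_natDegree
    conv_lhs => rw [g.as_sum_range_C_mul_X_pow, hgdeg]
    simp only [Finset.sum_range_succ, Finset.range_zero, Finset.sum_empty, h2, map_one]
    ring
  generalize P'.coeff 1 = α at hP'eq
  generalize P'.coeff 0 = β at hP'eq
  generalize g.coeff 0 = δ at hgeq
  set W : ℂ[X] := C κ * (((X ^ 2 + C α * X + C β) ^ 2 + 2 * X * (X ^ 2 + C α * X + C β)
    * (2 * X + C α)) * (X + C δ) - X * (X ^ 2 + C α * X + C β) ^ 2) with hWdef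
  have hW : derivative (X * P' ^ 2) * (C κ * g) - X * P' ^ 2 * derivative (C κ * g) = W := by
    rw [hP'eq, hgeq, hWdef]
    simp [derivative_pow, map_ofNat]
    ring
  rw [hW] at hdvd
  have h0 := eq_zero_of_dvd_of_natDegree_lt hdvd (by
    rw [hprod, Nat.lt_succ_iff, hWdef]
    compute_degree!)
  have h5 : W.coeff 5 = 4 * κ := by
    rw [hWdef]
    compute_degree!
    ring
  simp [h0, hκ] at h5

/-- The first integral of the symmetric square of the Lamé equation with singularities
`0, 1, d, ∞`, evaluated on `√X * P` and multiplied by 4. -/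
noncomputable def lameFirstIntegral (d : ℂ) (P : ℂ[X]) : ℂ[X] :=
  4 * (X * ((X - 1) * (X - C d))) * (4 * P * derivative P + 2 * X * derivative P ^ 2
      + 2 * X * P * derivative (derivative P))
    + 2 * ((X - 1) * (X - C d) + X * (X - C d) + X * (X - 1)) * (P ^ 2 + 2 * X * P * derivative P)
    - 3 * ((X - 1) * (X - C d)) * (P + 2 * X * derivative P) ^ 2

theorem dvd_lameFirstIntegral_mul {p q r F : ℂ[X]} {κ t d : ℂ}
    (hp : p ≠ 0) (hq : q ≠ 0) (hr : r ≠ 0)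
    (h₁ : X * p ^ 2 - (X - 1) * q ^ 2 = F)
    (h₂ : X * p ^ 2 - (X - C d) * r ^ 2 = C t * F)
    (hW : derivative (X * p ^ 2) * F - X * p ^ 2 * derivative F = 4 * C κ * (p * q * r)) :
    X * p ^ 2 ∣ (lameFirstIntegral d p + 16 * C κ ^ 2 * C t) * F ^ 2 := by
  have hW' := congrArg derivative hW
  have h₁' := congrArg derivative h₁
  have h₂' := congrArg derivative h₂
  simp only [derivative_mul, derivative_pow, derivative_sub, derivative_X, derivative_one,
    derivative_C, Nat.cast_ofNat, map_ofNat, derivative_add, derivative_ofNat] at hW' h₁' h₂' hW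
  norm_num at hW' h₁' h₂' hW
  have hE₁ : (p + 2 * X * derivative p) * F - X * p * derivative F = 4 * C κ * (q * r) :=
    mul_left_cancel₀ hp (by linear_combination hW)
  have hE₂ : (q + 2 * (X - 1) * derivative q) * F - (X - 1) * q * derivative F
      = 4 * C κ * (p * r) :=
    mul_left_cancel₀ hq (by linear_combination hW - F * h₁' + derivative F * h₁)
  have hE₃ : (r + 2 * (X - C d) * derivative r) * F - (X - C d) * r * derivative F
      = 4 * C κ * (p * q) :=
    mul_left_cancel₀ hr (by linear_combination hW - F * h₂' + derivative F * h₂)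
  refine ⟨F * (4 * (X * ((X - 1) * (X - C d))) * derivative (derivative F)
      + 2 * ((X - 1) * (X - C d) + X * (X - C d) + X * (X - 1)) * derivative F)
    - 3 * (X * ((X - 1) * (X - C d))) * derivative F ^ 2
    + 16 * C κ ^ 2 * (X * p ^ 2 + (X - 1) * q ^ 2 + (X - C d) * r ^ 2), ?_⟩
  rw [lameFirstIntegral]
  linear_combination 4 * (X * ((X - 1) * (X - C d))) * F * hW'
    + 2 * ((X - 1) * (X - C d) + X * (X - C d) + X * (X - 1)) * F * p * hE₁
    - 3 * ((X - 1) * (X - C d)) * ((p + 2 * X * derivative p) * F + X * p * derivative F) * hE₁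
    - 4 * C κ * ((X - 1) * (X - C d)) * q * r * hE₁
    + 8 * C κ * (X * (X - C d)) * p * r * hE₂
    + 8 * C κ * (X * (X - 1)) * p * q * hE₃
    - 16 * C κ ^ 2 * F * h₂ - 16 * C κ ^ 2 * (X * p ^ 2 - (X - C d) * r ^ 2) * h₁

/-- The Wronskian of a degree 7 pencil with contact of order 4 at infinity is proportional to the
product of the three cubics. -/
theorem pencil_wronskian_eq {t d κ a b c : ℂ} {P Q R f : ℂ[X]}
    (hP : P.Monic) (hPdeg : P.natDegree = 3) (hQ : Q.Monic) (hQdeg : Q.natDegree = 3)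
    (hR : R.Monic) (hRdeg : R.natDegree = 3)
    (hf : f = X ^ 3 - C a * X ^ 2 + C b * X - C c)
    (h₁ : X * P ^ 2 - (X - 1) * Q ^ 2 = C κ * f)
    (h₂ : X * P ^ 2 - (X - C d) * R ^ 2 = C t * (C κ * f))
    (hPQ : IsCoprime P Q) (hPR : IsCoprime P R) (hQR : IsCoprime Q R) :
    derivative (X * P ^ 2) * (C κ * f) - X * P ^ 2 * derivative (C κ * f)
      = 4 * C κ * (P * Q * R) := by
  obtain ⟨s, hs⟩ := mul_mul_dvd_pencil_wronskian h₁ h₂ hPQ hPR hQR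
  have hm : (P * Q * R).Monic := (hP.mul hQ).mul hR
  have hdeg : (P * Q * R).natDegree = 9 := by
    rw [(hP.mul hQ).natDegree_mul hR, hP.natDegree_mul hQ, hPdeg, hQdeg, hRdeg]
  obtain ⟨α, β, γ, hPeq⟩ := exists_eq_cubic_of_monic hP hPdeg
  set W : ℂ[X] := C κ * (((X ^ 3 + C α * X ^ 2 + C β * X + C γ) ^ 2
    + 2 * X * (X ^ 3 + C α * X ^ 2 + C β * X + C γ) * (3 * X ^ 2 + 2 * C α * X + C β))
      * (X ^ 3 - C a * X ^ 2 + C b * X - C c)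
    - X * (X ^ 3 + C α * X ^ 2 + C β * X + C γ) ^ 2 * (3 * X ^ 2 - 2 * C a * X + C b)) with hWdef
  have hW : derivative (X * P ^ 2) * (C κ * f) - X * P ^ 2 * derivative (C κ * f) = W := by
    rw [hPeq, hf, hWdef]
    simp [derivative_pow, map_ofNat]
    ring
  have hWdeg : W.natDegree ≤ 9 := by
    rw [hWdef]
    compute_degree!
  have hW9 : W.coeff 9 = 4 * κ := by
    rw [hWdef]
    compute_degree!
    ring
  rw [hW] at hs ⊢
  have hs0 : s.natDegree = 0 := by
    rcases eq_or_ne s 0 with rfl | h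
    · simp
    · rw [hs, hm.natDegree_mul' h, hdeg] at hWdeg
      omega
  rw [eq_C_of_natDegree_eq_zero hs0] at hs
  have h9 : (P * Q * R).coeff 9 = 1 := hdeg ▸ hm.coeff_natDegree
  rw [hs, coeff_mul_C, h9, one_mul] at hW9
  rw [hs, hW9, C_mul, map_ofNat]
  ring

/-- if a degree 7 Frey-Kani covering of ramification type II,i exists
for the branch parameters `t` and `d`, then `t` and `d` satisfy the displayed
degree 16 relation. -/
theorem stmt_16 (t d : ℂ) (hd0 : d ≠ 0) (hd1 : d ≠ 1) (ht0 : t ≠ 0) (ht1 : t ≠ 1)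
    (hA1 : 90 * d ^ 4 * t ^ 2 - 36 * d ^ 7 * t - 9 * t ^ 2 * d - 84 * t ^ 2 * d ^ 3
      + 36 * t ^ 2 * d ^ 2 + t ^ 3 - d ^ 9 + 36 * t * d ^ 4 - 90 * t * d ^ 5
      + 84 * t * d ^ 6 + 9 * t * d ^ 8 - 36 * d ^ 5 * t ^ 2 ≠ 0)
    (hA2 : 168 * t * d ^ 6 - t ^ 2 - 168 * t * d ^ 5 - 20 * t * d ^ 3 + 6 * t ^ 2 * d
      - 10 * t ^ 2 * d ^ 2 + 5 * t ^ 2 * d ^ 3 + 90 * t * d ^ 4 - 90 * d ^ 7 * t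
      + 20 * t * d ^ 8 - 6 * d ^ 10 + d ^ 11 + 10 * d ^ 9 - 5 * d ^ 8 ≠ 0)
    (k : ℂ) (hk : k ≠ 0) (a b c : ℂ) (P₁ P₂ P₃ : ℂ[X])
    (hP₁ : P₁.Monic) (hP₁deg : P₁.natDegree = 3)
    (hP₂ : P₂.Monic) (hP₂deg : P₂.natDegree = 3)
    (hP₃ : P₃.Monic) (hP₃deg : P₃.natDegree = 3)
    (f : ℂ[X]) (hf : f = X ^ 3 - C a * X ^ 2 + C b * X - C c)
    (hid1 : C k * (X * P₁ ^ 2) - f = C k * ((X - 1) * P₂ ^ 2))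
    (hid2 : C k * (X * P₁ ^ 2) - C t * f = C k * ((X - C d) * P₃ ^ 2))
    (hf0 : f.eval 0 ≠ 0) (hf1 : f.eval 1 ≠ 0) (hfd : f.eval d ≠ 0) :
    d ^ 16 - 16 * (t * d ^ 15 + t ^ 3 * d) + 120 * t * d ^ 14 - 560 * t * d ^ 13
      + (400 * t ^ 2 + 1420 * t) * d ^ 12 - (2400 * t ^ 2 + 1968 * t) * d ^ 11
      + (6608 * t ^ 2 + 1400 * t) * d ^ 10 - (11040 * t ^ 2 + 400 * t) * d ^ 9
      + 12870 * t ^ 2 * d ^ 8 - (400 * t ^ 3 + 11040 * t ^ 2) * d ^ 7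
      + 120 * t ^ 3 * d ^ 2 + (1400 * t ^ 3 + 6608 * t ^ 2) * d ^ 6
      - (1968 * t ^ 3 + 2400 * t ^ 2) * d ^ 5
      + (1420 * t ^ 3 + 400 * t ^ 2) * d ^ 4 - 560 * t ^ 3 * d ^ 3 + t ^ 4 = 0 := by
  obtain ⟨κ, hκ, hkκ⟩ : ∃ κ : ℂ, κ ≠ 0 ∧ k * κ = 1 :=
    ⟨k⁻¹, inv_ne_zero hk, mul_inv_cancel₀ hk⟩
  have hC : C k * C κ = 1 := by rw [← C_mul, hkκ, C_1]
  have h₁ : X * P₁ ^ 2 - (X - 1) * P₂ ^ 2 = C κ * f := by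
    linear_combination C κ * hid1 - (X * P₁ ^ 2 - (X - 1) * P₂ ^ 2) * hC
  have h₂ : X * P₁ ^ 2 - (X - C d) * P₃ ^ 2 = C t * (C κ * f) := by
    linear_combination C κ * hid2 - (X * P₁ ^ 2 - (X - C d) * P₃ ^ 2) * hC
  have e₁ : ∀ x, x * P₁.eval x ^ 2 - (x - 1) * P₂.eval x ^ 2 = κ * f.eval x := fun x => by
    simpa using congrArg (eval x) h₁
  have e₂ : ∀ x, x * P₁.eval x ^ 2 - (x - d) * P₃.eval x ^ 2 = t * (κ * f.eval x) := fun x => by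
    simpa using congrArg (eval x) h₂
  have no_common : ∀ r, P₁.eval r = 0 → P₂.eval r = 0 → P₃.eval r = 0 → False := fun r =>
    no_common_root_of_pencil ht0 ht1 hκ hP₁ hP₁deg hP₂ hP₂deg hP₃ hP₃deg hf h₁ h₂
  have c₁₂ : IsCoprime P₁ P₂ := isCoprime_of_forall_not_common_root fun r h h' => by
    have hfr : f.eval r = 0 := by simpa [h, h', hκ] using (e₁ r).symm
    have h3 : r - d = 0 ∨ P₃.eval r = 0 := by simpa [h, hfr] using e₂ r
    rcases h3 with h3 | h3
    · exact hfd (sub_eq_zero.1 h3 ▸ hfr)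
    · exact no_common r h h' h3
  have c₁₃ : IsCoprime P₁ P₃ := isCoprime_of_forall_not_common_root fun r h h' => by
    have hfr : f.eval r = 0 := by simpa [h, h', hκ, ht0] using (e₂ r).symm
    have h3 : r - 1 = 0 ∨ P₂.eval r = 0 := by simpa [h, hfr] using e₁ r
    rcases h3 with h3 | h3
    · exact hf1 (sub_eq_zero.1 h3 ▸ hfr)
    · exact no_common r h h3 h'
  have c₂₃ : IsCoprime P₂ P₃ := isCoprime_of_forall_not_common_root fun r h h' => by
    have hfr : f.eval r = 0 := by
      have h3 : (t - 1) * κ * f.eval r = 0 := by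
        linear_combination e₁ r - e₂ r + (r - 1) * P₂.eval r * h - (r - d) * P₃.eval r * h'
      simpa [hκ, sub_eq_zero, ht1] using h3
    have h3 : r = 0 ∨ P₁.eval r = 0 := by simpa [h, hfr] using e₁ r
    rcases h3 with h3 | h3
    · exact hf0 (h3 ▸ hfr)
    · exact no_common r h3 h h'
  have hcop : IsCoprime (X * P₁ ^ 2) (C κ * f) := by
    refine isCoprime_of_forall_not_common_root fun r h h' => ?_
    have hfr : f.eval r = 0 := by simpa [hκ] using h'
    have h3 : r = 0 ∨ P₁.eval r = 0 := by simpa using h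
    rcases h3 with rfl | h3
    · exact hf0 hfr
    have h4 : r - 1 = 0 ∨ P₂.eval r = 0 := by simpa [h3, hfr] using e₁ r
    rcases h4 with h4 | h4
    · exact hf1 (sub_eq_zero.1 h4 ▸ hfr)
    · obtain ⟨u, v, huv⟩ := c₁₂
      simpa [h3, h4] using congrArg (eval r) huv
  obtain ⟨s, hs⟩ := hcop.pow_right.dvd_of_dvd_mul_right
    (dvd_lameFirstIntegral_mul hP₁.ne_zero hP₂.ne_zero hP₃.ne_zero h₁ h₂
      (pencil_wronskian_eq hP₁ hP₁deg hP₂ hP₂deg hP₃ hP₃deg hf h₁ h₂ c₁₂ c₁₃ c₂₃))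
  have hA : (X * P₁ ^ 2).Monic := monic_X.mul (hP₁.pow 2)
  have hAdeg : (X * P₁ ^ 2).natDegree = 7 := by
    rw [monic_X.natDegree_mul (hP₁.pow 2), natDegree_pow, hP₁deg, natDegree_X]
  obtain ⟨α, β, γ, rfl⟩ := exists_eq_cubic_of_monic hP₁ hP₁deg
  obtain ⟨α₂, β₂, γ₂, rfl⟩ := exists_eq_cubic_of_monic hP₂ hP₂deg
  obtain ⟨α₃, β₃, γ₃, rfl⟩ := exists_eq_cubic_of_monic hP₃ hP₃deg
  have hs1 : s.natDegree ≤ 1 := by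
    rcases eq_or_ne s 0 with rfl | h
    · simp
    · have hM : (lameFirstIntegral d (X ^ 3 + C α * X ^ 2 + C β * X + C γ)
          + 16 * C κ ^ 2 * C t).natDegree ≤ 8 := by
        have hd : derivative (X ^ 3 + C α * X ^ 2 + C β * X + C γ)
            = 3 * X ^ 2 + 2 * C α * X + C β := by
          simp [map_ofNat]
          ring
        have hdd : derivative (3 * X ^ 2 + 2 * C α * X + C β) = 6 * X + 2 * C α := by
          simp
          ring
        rw [lameFirstIntegral, hd, hdd]
        compute_degree!
      rw [hs, hA.natDegree_mul' h, hAdeg] at hM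
      omega
  obtain ⟨q₁, q₀, rfl⟩ := exists_eq_X_add_C_of_natDegree_le_one hs1
  obtain ⟨hβ, hγ, hB⟩ := symmSquare_coeffs (d := d) (α := α) (β := β) (γ := γ) (q₀ := q₀)
    (q₁ := q₁) (s := 16 * κ ^ 2 * t) fun x => by
      have := congrArg (eval x) hs
      simp [lameFirstIntegral] at this
      linear_combination this
  have hκ₁ := contact_coeff (e := 1) (τ := κ) (a := a) (b := b) (c := c) fun x => by
    simpa [hf] using e₁ x
  have hκ₂ := contact_coeff (e := d) (τ := t * κ) (a := a) (b := b) (c := c) fun x => by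
    simpa [hf, mul_assoc] using e₂ x
  refine eliminate_subleading_coeff hB ?_
  linear_combination 2 * hκ₂ - 2 * t * hκ₁ - 3 * (t - d ^ 2) * hβ - 4 * (t - d) * hγ
end
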